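/- arXiv:1405.5188 — 3 statements merged into one kernel-verified Lean document; each statement's English description precedes it below -/
import Mathlib

section
/- Let (R, m) be a commutative Noetherian local ring, and let M and N be nonzero finitely generated R-modules. Assume N is strongly-rigid and Ext^n_R(M,N) = 0 for some integer n ≥ depth(R). Then pd(M) ≤ n - 1, and pd(M) = sup{i : Ext^i_R(M,N) ≠ 0}. -/
open CategoryTheory

noncomputable section

variable (R : Type) [CommRing R]

/-- `Ext^n_R(M,N)` as an `R`-module object. -/
abbrev ext (n : ℕ) (M N : ModuleCat R) : ModuleCat R :=
  ((Ext R (ModuleCat R) n).obj (Opposite.op M)).obj N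

/-- `Tor_n^R(M,N)`. -/
abbrev tor (n : ℕ) (M N : ModuleCat R) : ModuleCat R :=
  ((Tor (ModuleCat R) n).obj M).obj N

/-- projective dimension, via vanishing of `Ext` in degrees above `n`. -/
def projDim (M : ModuleCat R) : ℕ∞ :=
  sInf {n : ℕ∞ | ∀ (i : ℕ) (X : ModuleCat R), n < i → Subsingleton (ext R i M X)}

/-- injective dimension, via vanishing of `Ext` in degrees above `n`. -/
def injDim (N : ModuleCat R) : ℕ∞ :=
  sInf {n : ℕ∞ | ∀ (i : ℕ) (X : ModuleCat R), n < i → Subsingleton (ext R i X N)}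

/-- depth over a local ring, as the least `n` with `Ext^n(k, N) ≠ 0`. -/
def depth [IsLocalRing R] (N : ModuleCat R) : ℕ∞ :=
  sInf {n : ℕ∞ | ∃ i : ℕ, n = i ∧
    ¬ Subsingleton (ext R i (ModuleCat.of R (IsLocalRing.ResidueField R)) N)}

/-- Tor-rigidity. -/
def TorRigid (N : ModuleCat R) : Prop :=
  ∀ (X : ModuleCat R), Module.Finite R X → ∀ n : ℕ, 1 ≤ n →
    Subsingleton (tor R n N X) → Subsingleton (tor R (n + 1) N X)

/-- test module for projectivity. -/
def TestModule (M : ModuleCat R) : Prop :=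
  ∀ (X : ModuleCat R), Module.Finite R X → projDim R X = ⊤ →
    {j : ℕ | ¬ Subsingleton (tor R j M X)}.Infinite

/-- strongly-rigid module. -/
def StronglyRigid (N : ModuleCat R) : Prop :=
  ∀ (X : ModuleCat R), Module.Finite R X → ∀ n : ℕ, 1 ≤ n →
    Subsingleton (tor R n N X) → projDim R X < ⊤

/-- rigid-test module. -/
def RigidTest (N : ModuleCat R) : Prop :=
  ∀ (X : ModuleCat R), Module.Finite R X → ∀ n : ℕ, 1 ≤ n →
    Subsingleton (tor R n N X) →
      Subsingleton (tor R (n + 1) N X) ∧ projDim R X < ⊤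


namespace Aux7
section
variable {R}

lemma exactAt_iff_lin (P : ChainComplex (ModuleCat R) ℕ) (N : ModuleCat R) (n p : ℕ)
    (hp : (ComplexShape.up ℕ).prev n = p) :
    (P.linearYonedaObj R N).ExactAt n ↔
      ∀ f : P.X n ⟶ N, P.d (n+1) n ≫ f = 0 → ∃ g : P.X p ⟶ N, P.d n p ≫ g = f := by
  rw [HomologicalComplex.exactAt_iff' _ p n (n+1) hp (by simp),
    ShortComplex.moduleCat_exact_iff]
  rfl

lemma subsingleton_ext_iff_lin (n p : ℕ) (hp : (ComplexShape.up ℕ).prev n = p)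
    (M N : ModuleCat R) (P : ProjectiveResolution M) :
    Subsingleton (ext R n M N) ↔ 
      ∀ f : P.complex.X n ⟶ N, P.complex.d (n+1) n ≫ f = 0 →
        ∃ g : P.complex.X p ⟶ N, P.complex.d n p ≫ g = f := by
  rw [← exactAt_iff_lin _ _ _ _ hp, HomologicalComplex.exactAt_iff_isZero_homology,
    ← (P.isoExt (R := R) n N).isZero_iff, ModuleCat.isZero_iff_subsingleton]

lemma ext_iff (n : ℕ) (M N : ModuleCat R) :
    Subsingleton (ext R n M N) ↔ Subsingleton (Abelian.Ext M N n) := by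
  have P := projectiveResolution M
  cases n with
  | zero =>
    rw [subsingleton_ext_iff_lin 0 0 (by simp) M N P]
    rw [(Abelian.Ext.addEquiv₀ (X := M) (Y := N)).toEquiv.subsingleton_congr]
    have hex := P.exact₀
    let π : P.complex.X 0 ⟶ M := P.π.f 0
    have hepi : Epi π := (inferInstance : Epi (P.π.f 0))
    have hzero : P.complex.d 1 0 ≫ π = 0 := P.complex_d_comp_π_f_zero
    constructor
    · intro h
      refine subsingleton_of_forall_eq 0 fun f => ?_
      obtain ⟨g, hg⟩ := h (π ≫ f) (by
        rw [← Category.assoc]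
        exact (congrArg (· ≫ f) hzero).trans Limits.zero_comp)
      rw [P.complex.shape _ _ (by simp)] at hg
      rw [← cancel_epi π, ← hg]
      simp
    · intro h f hf
      refine ⟨0, ?_⟩
      obtain ⟨l, hl⟩ := hex.desc' f hf
      have h0 : l = 0 := h.elim (α := (M ⟶ N)) l 0
      rw [← hl, h0]
      simp only [Limits.comp_zero]
  | succ n =>
    rw [subsingleton_ext_iff_lin (n+1) n (by simp) M N P]
    constructor
    · intro h
      refine subsingleton_of_forall_eq 0 fun a => ?_
      obtain ⟨f, hf, rfl⟩ := P.extMk_surjective a (n+2) rfl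
      rw [P.extMk_eq_zero_iff f _ rfl hf n rfl]
      exact h f hf
    · intro h f hf
      rw [← P.extMk_eq_zero_iff f _ rfl hf n rfl]
      exact h.elim _ _

end
end Aux7

namespace Aux7
section
variable {R}

open TensorProduct in
lemma lTensor_inj_indep {N T P G : Type} [AddCommGroup N] [Module R N] [AddCommGroup T]
    [Module R T] [AddCommGroup P] [Module R P] [AddCommGroup G] [Module R G]
    [Module.Projective R P] [Module.Projective R G]
    (π : G →ₗ[R] T) (hπ : Function.Surjective π) (ρ : P →ₗ[R] T) (hρ : Function.Surjective ρ)
    (hinj : Function.Injective ((LinearMap.ker π).subtype.lTensor N)) :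
    Function.Injective ((LinearMap.ker ρ).subtype.lTensor N) := by
  obtain ⟨a, ha⟩ := Module.projective_lifting_property π ρ hπ
  obtain ⟨b, hb⟩ := Module.projective_lifting_property ρ π hρ
  have ha' : ∀ x, π (a x) = ρ x := fun x => LinearMap.congr_fun ha x
  have hb' : ∀ x, ρ (b x) = π x := fun x => LinearMap.congr_fun hb x
  let a' : LinearMap.ker ρ →ₗ[R] LinearMap.ker π :=
    (a.comp (LinearMap.ker ρ).subtype).codRestrict _ (by
      rintro ⟨x, hx⟩; simpa [ha'] using hx)
  let b' : LinearMap.ker π →ₗ[R] LinearMap.ker ρ :=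
    (b.comp (LinearMap.ker π).subtype).codRestrict _ (by
      rintro ⟨x, hx⟩; simpa [hb'] using hx)
  let h : P →ₗ[R] LinearMap.ker ρ :=
    (LinearMap.id - b.comp a).codRestrict _ (by
      intro x; simp [hb', ha'])
  have e1 : (LinearMap.id : LinearMap.ker ρ →ₗ[R] LinearMap.ker ρ) =
      h.comp (LinearMap.ker ρ).subtype + b'.comp a' := by
    refine LinearMap.ext fun x => Subtype.ext ?_
    simp [h, a', b']
  have e2 : (LinearMap.ker π).subtype.comp a' = a.comp (LinearMap.ker ρ).subtype := rfl
  rw [injective_iff_map_eq_zero]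
  intro x hx
  have h1 : a'.lTensor N x = 0 := by
    apply hinj
    rw [map_zero, ← LinearMap.lTensor_comp_apply, e2, LinearMap.lTensor_comp_apply, hx, map_zero]
  have := congrArg (fun f => f.lTensor N x) e1
  simp only [LinearMap.lTensor_id, LinearMap.lTensor_add, LinearMap.add_apply,
    LinearMap.lTensor_comp_apply, hx, h1, map_zero, LinearMap.id_apply] at this
  simpa using this

lemma lTensor_exact_of_inj {N T P₀ P₁ P₂ : Type} [AddCommGroup N] [Module R N] [AddCommGroup T]
    [Module R T] [AddCommGroup P₀] [Module R P₀] [AddCommGroup P₁] [Module R P₁]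
    [AddCommGroup P₂] [Module R P₂] (d₂ : P₂ →ₗ[R] P₁) (d₁ : P₁ →ₗ[R] P₀) (ρ : P₀ →ₗ[R] T)
    (h₂ : Function.Exact d₂ d₁) (h₁ : Function.Exact d₁ ρ)
    (hinj : Function.Injective ((LinearMap.ker ρ).subtype.lTensor N)) :
    Function.Exact (d₂.lTensor N) (d₁.lTensor N) := by
  let d' : P₁ →ₗ[R] LinearMap.ker ρ := d₁.codRestrict _ fun x => h₁.apply_apply_eq_zero x
  have hd' : Function.Surjective d' := by
    rintro ⟨y, hy⟩
    obtain ⟨x, rfl⟩ := (h₁ y).1 hy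
    exact ⟨x, rfl⟩
  have hex : Function.Exact d₂ d' := by
    intro x
    rw [← h₂ x, Subtype.ext_iff]; rfl
  have := lTensor_exact N hex hd'
  have e : d₁ = (LinearMap.ker ρ).subtype.comp d' := rfl
  intro x
  rw [e, LinearMap.lTensor_comp_apply, ← this x]
  exact map_eq_zero_iff _ hinj

lemma tor_one_vanish (N T : ModuleCat R) {G : Type} [AddCommGroup G] [Module R G]
    [Module.Projective R G] (π : G →ₗ[R] T) (hπ : Function.Surjective π)
    (hinj : Function.Injective ((LinearMap.ker π).subtype.lTensor N)) :
    Subsingleton (tor R 1 N T) := by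
  have P := projectiveResolution T
  let ρ : P.complex.X 0 ⟶ T := P.π.f 0
  have hepi : Epi ρ := (inferInstance : Epi (P.π.f 0))
  have hρ : Function.Surjective ρ.hom := (ModuleCat.epi_iff_surjective ρ).1 hepi
  have : Module.Projective R (P.complex.X 0) :=
    (IsProjective.iff_projective _).2 (inferInstanceAs (Projective (P.complex.X 0)))
  have h0 := lTensor_inj_indep π hπ ρ.hom hρ hinj
  rw [← ModuleCat.isZero_iff_subsingleton]
  refine Limits.IsZero.of_iso ?_ (P.isoLeftDerivedObj ((MonoidalCategory.tensoringLeft _).obj N) 1)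
  refine (HomologicalComplex.exactAt_iff_isZero_homology _ _).1 ?_
  rw [HomologicalComplex.exactAt_iff' _ 2 1 0 (by simp) (by simp),
    ShortComplex.moduleCat_exact_iff]
  have hex1 : Function.Exact (P.complex.d 1 0).hom ρ.hom :=
    (ShortComplex.ShortExact.moduleCat_exact_iff_function_exact _).1 P.exact₀
  have hex2 : Function.Exact (P.complex.d 2 1).hom (P.complex.d 1 0).hom := 
    (ShortComplex.ShortExact.moduleCat_exact_iff_function_exact _).1 (P.exact_succ 0)
  have := lTensor_exact_of_inj (N := N) _ _ _ hex2 hex1 h0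
  intro x hx
  exact (this x).1 hx

end
end Aux7

namespace Aux7
section
variable {R}

/-- `s • id` factors through a free module of rank `t` for some `s ∉ q`. -/
def QFree (q : Ideal R) (t : ℕ) (S : Type) [AddCommGroup S] [Module R S] : Prop :=
  ∃ s, s ∉ q ∧ ∃ (α : S →ₗ[R] (Fin t → R)) (w : Fin t → S), ∀ x, s • x = ∑ i, α x i • w i

lemma QFree.reduce {q : Ideal R} [q.IsPrime] {t : ℕ} {S : Type} [AddCommGroup S] [Module R S]
    {s : R} (hs : s ∉ q) (α : S →ₗ[R] (Fin (t+1) → R)) (w : Fin (t+1) → S)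
    (h : ∀ x, s • x = ∑ i, α x i • w i) (c : Fin (t+1) → R) (j : Fin (t+1)) (hj : c j ∉ q)
    (hc : ∀ k, α (∑ i, c i • w i) k ∈ q) : QFree q t S := by
  set p := α (∑ i, c i • w i) with hp
  have h1 : ∑ i, (s * c i - p i) • w i = 0 := by
    simp only [sub_smul, Finset.sum_sub_distrib, mul_smul, ← Finset.smul_sum]
    rw [h, sub_self]
  set e : Fin (t+1) → R := fun i => s * c i - p i with he
  change ∑ i, e i • w i = 0 at h1
  have hu : e j ∉ q := by
    intro hh
    have : s * c j ∈ q := by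
      have := q.add_mem hh (hc j)
      simpa [he] using this
    rcases Ideal.IsPrime.mem_or_mem ‹_› this with h | h
    · exact hs h
    · exact hj h
  rw [Fin.sum_univ_succAbove _ j] at h1
  refine ⟨e j * s, fun hh => ?_, ?_⟩
  · rcases Ideal.IsPrime.mem_or_mem ‹_› hh with h | h
    · exact hu h
    · exact hs h
  refine ⟨LinearMap.pi fun i => e j • (LinearMap.proj (j.succAbove i) ∘ₗ α) -
    e (j.succAbove i) • (LinearMap.proj j ∘ₗ α), fun i => w (j.succAbove i), fun x => ?_⟩
  rw [mul_smul, h, Fin.sum_univ_succAbove _ j, smul_add, smul_comm (e j),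
    eq_neg_of_add_eq_zero_left h1]
  simp only [LinearMap.pi_apply, LinearMap.sub_apply, LinearMap.smul_apply, sub_smul,
    Finset.sum_sub_distrib, LinearMap.comp_apply, LinearMap.proj_apply, smul_eq_mul, mul_smul,
    ← Finset.smul_sum, smul_neg]
  rw [neg_add_eq_sub]
  congr 1
  simp only [Finset.smul_sum]
  exact Finset.sum_congr rfl fun i _ => smul_comm (α x j) (e (j.succAbove i)) (w (j.succAbove i))

/-- A matrix over `R` whose reduction modulo a prime is injective has a left inverse
up to an element outside the prime. -/
lemma exists_left_inv {q : Ideal R} [q.IsPrime] {t g : ℕ} (V : Matrix (Fin g) (Fin t) R)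
    (hV : ∀ c : Fin t → R, (∀ k, V.mulVec c k ∈ q) → ∀ j, c j ∈ q) :
    ∃ (δ : R) (W : Matrix (Fin t) (Fin g) R), δ ∉ q ∧ W * V = δ • 1 := by
  let D := R ⧸ q
  let κ := FractionRing D
  let V' : Matrix (Fin g) (Fin t) κ := V.map (fun a => algebraMap D κ (Ideal.Quotient.mk q a))
  have hinj : Function.Injective V'.mulVecLin := by
    rw [injective_iff_map_eq_zero]
    intro x hx
    obtain ⟨b, hb⟩ := IsLocalization.exist_integer_multiples_of_finite (nonZeroDivisors D) x
    choose y hy using hb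
    choose c hc using fun i => Ideal.Quotient.mk_surjective (I := q) (y i)
    have h0 : ∀ k, V.mulVec c k ∈ q := by
      intro k
      rw [← Ideal.Quotient.eq_zero_iff_mem]
      apply IsFractionRing.injective D κ
      have := congrFun hx k
      simp only [Matrix.mulVecLin_apply, Matrix.mulVec, dotProduct, Pi.zero_apply] at this ⊢
      simp only [map_sum, map_mul, map_zero, hc, hy]
      have h2 := congrArg (fun z => (b : D) • z) this
      simpa [V', Finset.smul_sum, mul_smul_comm] using h2
    have := hV c h0
    funext j
    have hj := hy j
    rw [← hc, Ideal.Quotient.eq_zero_iff_mem.2 (this j), map_zero, Algebra.smul_def] at hj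
    have hb0 : algebraMap D κ b ≠ 0 := by
      rw [Ne, map_eq_zero_iff _ (IsFractionRing.injective D κ)]
      exact nonZeroDivisors.ne_zero b.2
    simpa [hb0] using hj.symm
  obtain ⟨l, hl⟩ := LinearMap.exists_leftInverse_of_injective V'.mulVecLin (LinearMap.ker_eq_bot.2 hinj)
  let W' := LinearMap.toMatrix' l
  have hW' : W' * V' = 1 := by
    have := congrArg LinearMap.toMatrix' hl
    rw [LinearMap.toMatrix'_comp] at this
    simpa [← Matrix.toLin'_apply', W'] using this
  obtain ⟨b, hb⟩ := IsLocalization.exist_integer_multiples_of_finite (nonZeroDivisors D)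
    (fun p : Fin t × Fin g => W' p.1 p.2)
  choose y hy using hb
  choose c hc using fun i => Ideal.Quotient.mk_surjective (I := q) (y i)
  obtain ⟨b', hb'⟩ := Ideal.Quotient.mk_surjective (I := q) (b : D)
  let W : Matrix (Fin t) (Fin g) R := fun i j => c (i, j)
  have hWe : ∀ i j, Ideal.Quotient.mk q (W i j) = y (i, j) := fun i j => hc (i, j)
  have hWV : (W * V).map (Ideal.Quotient.mk q) = (b : D) • 1 := by
    refine Matrix.ext fun i j => ?_
    apply IsFractionRing.injective D κ
    have h1 := congrArg (fun z => (b : D) • z) (congrFun (congrFun hW' i) j)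
    simp only [Matrix.mul_apply, Finset.smul_sum] at h1
    simp only [Matrix.map_apply, Matrix.mul_apply, map_sum, map_mul, hWe, hy, Matrix.smul_apply,
      smul_eq_mul]
    simp only [← smul_mul_assoc, V'] at h1
    refine h1.trans ?_
    rw [Algebra.smul_def]
    congr 1
    simp [Matrix.one_apply, apply_ite (algebraMap D κ)]
  refine ⟨(W * V).det, (W * V).adjugate * W, ?_, ?_⟩
  · rw [← Ideal.Quotient.eq_zero_iff_mem, RingHom.map_det, RingHom.mapMatrix_apply, hWV,
      Matrix.det_smul, Matrix.det_one, mul_one]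
    exact pow_ne_zero _ (nonZeroDivisors.ne_zero b.2)
  · rw [Matrix.mul_assoc, Matrix.adjugate_mul]

lemma QFree.exists_retraction {q : Ideal R} [hq : q.IsPrime] {K : Type} [AddCommGroup K]
    [Module R K] {g : ℕ} (ι : K →ₗ[R] (Fin g → R)) {t : ℕ} (hK : QFree q t K)
    (hv : ∀ v : K, (∀ i, ι v i ∈ q) → ∀ φ : K →ₗ[R] R, φ v ∈ q) :
    ∃ s, s ∉ q ∧ ∃ ρ : (Fin g → R) →ₗ[R] K, ∀ x, ρ (ι x) = s • x := by
  classical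
  have hex : ∃ t, QFree q t K := ⟨t, hK⟩
  obtain ⟨s, hs, α, w, h⟩ := Nat.find_spec hex
  have hmin := fun m => Nat.find_min (m := m) hex
  revert α w
  generalize Nat.find hex = t at hmin
  intro α w h
  let V : Matrix (Fin g) (Fin t) R := fun i l => ι (w l) i
  have hVc : ∀ c : Fin t → R, V.mulVec c = ι (∑ i, c i • w i) := by
    intro c
    funext k
    simp [V, Matrix.mulVec, dotProduct, mul_comm]
  obtain ⟨δ, W, hδ, hW⟩ := exists_left_inv (q := q) V (by
    intro c hc j
    by_contra hj
    obtain _ | t := t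
    · exact j.elim0
    · refine hmin t (Nat.lt_succ_self t) (QFree.reduce hs α w h c j hj ?_)
      intro k
      refine hv _ ?_ (LinearMap.proj k ∘ₗ α)
      intro i
      rw [← hVc]
      exact hc i)
  have hb : ∀ c : Fin t → R, W.mulVec (ι (∑ i, c i • w i)) = δ • c := by
    intro c
    rw [← hVc, Matrix.mulVec_mulVec, hW, Matrix.smul_mulVec, Matrix.one_mulVec]
  refine ⟨s * δ, fun hh => (hq.mem_or_mem hh).elim hs hδ,
    s • ((Fintype.linearCombination R w) ∘ₗ W.mulVecLin), fun x => ?_⟩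
  have e : s • W.mulVec (ι x) = δ • α x := by
    rw [← hb, ← h, map_smul, Matrix.mulVec_smul]
  simp only [LinearMap.smul_apply, LinearMap.comp_apply, Matrix.mulVecLin_apply]
  rw [← map_smul, e, map_smul, Fintype.linearCombination_apply, ← h, smul_smul, mul_comm]

/-- The cokernel of an up-to-`s` split map into a free module is `q`-free. -/
lemma QFree.of_retraction {q : Ideal R} {K S : Type} [AddCommGroup K]
    [Module R K] [AddCommGroup S] [Module R S] {g : ℕ} (ι : K →ₗ[R] (Fin g → R))
    (π : (Fin g → R) →ₗ[R] S) (hπ : Function.Surjective π) (hex : Function.Exact ι π)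
    {s : R} (hs : s ∉ q) (ρ : (Fin g → R) →ₗ[R] K) (hρ : ∀ x, ρ (ι x) = s • x) :
    QFree q g S := by
  let γ : (Fin g → R) →ₗ[R] (Fin g → R) := s • LinearMap.id - ι ∘ₗ ρ
  have hk : LinearMap.ker π ≤ LinearMap.ker γ := by
    intro x hx
    obtain ⟨y, rfl⟩ := (hex x).1 hx
    simp [γ, hρ]
  let e := π.quotKerEquivOfSurjective hπ
  have he : ∀ x, e.symm (π x) = (LinearMap.ker π).mkQ x := by
    intro x
    rw [LinearEquiv.symm_apply_eq]; rfl
  refine ⟨s, hs, ((LinearMap.ker π).liftQ γ hk) ∘ₗ e.symm.toLinearMap,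
    fun i => π (Pi.single i 1), fun x => ?_⟩
  obtain ⟨x, rfl⟩ := hπ x
  simp only [LinearMap.comp_apply, LinearEquiv.coe_coe, he, Submodule.mkQ_apply,
    Submodule.liftQ_apply, ← map_smul, ← map_sum]
  have : ∑ i, γ x i • (Pi.single i (1 : R) : Fin g → R) = γ x := by
    funext k; simp [Pi.single_apply]
  rw [this]
  simp [γ, hex.apply_apply_eq_zero]

end
end Aux7

namespace Aux7
section
variable {R}

/-- Pushforward on `Ext` along a linear map. -/
def push (L : ModuleCat R) (a : ℕ) {Y Z : Type} [AddCommGroup Y] [Module R Y] [AddCommGroup Z]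
    [Module R Z] (f : Y →ₗ[R] Z) (x : Abelian.Ext L (ModuleCat.of R Y) a) :
    Abelian.Ext L (ModuleCat.of R Z) a :=
  x.comp (Abelian.Ext.mk₀ (ModuleCat.ofHom f)) (add_zero a)

section
variable {L : ModuleCat R} {a : ℕ} {Y Z W : Type} [AddCommGroup Y] [Module R Y] [AddCommGroup Z]
    [Module R Z] [AddCommGroup W] [Module R W]

lemma push_comp (g : Z →ₗ[R] W) (f : Y →ₗ[R] Z) (x : Abelian.Ext L (ModuleCat.of R Y) a) :
    push L a (g ∘ₗ f) x = push L a g (push L a f x) := by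
  simp [push, ModuleCat.ofHom_comp]

lemma push_id (x : Abelian.Ext L (ModuleCat.of R Y) a) :
    push L a LinearMap.id x = x := by
  simp [push]

lemma push_zero (f : Y →ₗ[R] Z) : push L a f 0 = 0 := by
  simp [push]

lemma zero_push (x : Abelian.Ext L (ModuleCat.of R Y) a) :
    push L a (0 : Y →ₗ[R] Z) x = 0 := by
  have : ModuleCat.ofHom (0 : Y →ₗ[R] Z) = 0 := rfl
  simp [push, this]

lemma smul_push (r : R) (f : Y →ₗ[R] Z) (x : Abelian.Ext L (ModuleCat.of R Y) a) :
    push L a (r • f) x = r • push L a f x := by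
  have : ModuleCat.ofHom (r • f) = r • ModuleCat.ofHom f := rfl
  simp [push, this, Abelian.Ext.mk₀_smul]

lemma sum_push {ι : Type} [Fintype ι] (f : ι → (Y →ₗ[R] Z))
    (x : Abelian.Ext L (ModuleCat.of R Y) a) :
    push L a (∑ i, f i) x = ∑ i, push L a (f i) x := by
  have : ModuleCat.ofHom (∑ i, f i) = ∑ i, ModuleCat.ofHom (f i) := by
    refine ModuleCat.hom_ext ?_
    simp
  simp [push, this, Abelian.Ext.mk₀_sum, Abelian.Ext.comp_sum]

lemma push_pi_inj {g : ℕ} (x : Abelian.Ext L (ModuleCat.of R (Fin g → R)) a)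
    (h : ∀ i, push L a (LinearMap.proj i) x = 0) : x = 0 := by
  have e : (LinearMap.id : (Fin g → R) →ₗ[R] (Fin g → R)) =
      ∑ i, (LinearMap.single R (fun _ => R) i) ∘ₗ LinearMap.proj i := by
    refine LinearMap.ext fun v => ?_
    funext k
    simp [Pi.single_apply]
  rw [← push_id x, e, sum_push]
  simp [push_comp, h, push_zero]

/-- short exact sequence from linear maps -/
lemma ses (f : Y →ₗ[R] Z) (g : Z →ₗ[R] W) (hf : Function.Injective f)
    (hg : Function.Surjective g) (h : Function.Exact f g) :
    (ShortComplex.mk (ModuleCat.ofHom f) (ModuleCat.ofHom g)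
      (by rw [← ModuleCat.ofHom_comp, h.linearMap_comp_eq_zero]; rfl)).ShortExact :=
  ModuleCat.shortComplex_shortExact _ h hf hg

lemma push_injective (f : Y →ₗ[R] Z) (g : Z →ₗ[R] W) (hf : Function.Injective f)
    (hg : Function.Surjective g) (h : Function.Exact f g)
    (hW : ∀ b, b + 1 = a → Subsingleton (Abelian.Ext L (ModuleCat.of R W) b))
    (x : Abelian.Ext L (ModuleCat.of R Y) a) (hx : push L a f x = 0) : x = 0 := by
  have hS := ses f g hf hg h
  cases a with
  | zero =>
    have : Mono (ModuleCat.ofHom f) := (ModuleCat.mono_iff_injective _).2 hf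
    apply Abelian.Ext.postcomp_mk₀_injective_of_mono L (ModuleCat.ofHom f)
    rw [map_zero]
    exact hx
  | succ a =>
    obtain ⟨y, rfl⟩ := Abelian.Ext.covariant_sequence_exact₁ L hS x hx rfl
    have := hW a rfl
    rw [Subsingleton.elim (α := Abelian.Ext L (ModuleCat.of R W) a) y 0]
    exact Abelian.Ext.zero_comp ..

lemma sub_left (f : Y →ₗ[R] Z) (g : Z →ₗ[R] W) (hf : Function.Injective f)
    (hg : Function.Surjective g) (h : Function.Exact f g)
    (hW : ∀ b, b + 1 = a → Subsingleton (Abelian.Ext L (ModuleCat.of R W) b))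
    (hZ : Subsingleton (Abelian.Ext L (ModuleCat.of R Z) a)) :
    Subsingleton (Abelian.Ext L (ModuleCat.of R Y) a) :=
  subsingleton_of_forall_eq 0 fun x => push_injective f g hf hg h hW x (hZ.elim _ _)

lemma sub_right (f : Y →ₗ[R] Z) (g : Z →ₗ[R] W) (hf : Function.Injective f)
    (hg : Function.Surjective g) (h : Function.Exact f g)
    (hY : Subsingleton (Abelian.Ext L (ModuleCat.of R Y) (a + 1)))
    (hZ : Subsingleton (Abelian.Ext L (ModuleCat.of R Z) a)) :
    Subsingleton (Abelian.Ext L (ModuleCat.of R W) a) := by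
  have hS := ses f g hf hg h
  refine subsingleton_of_forall_eq 0 fun x => ?_
  obtain ⟨y, rfl⟩ := Abelian.Ext.covariant_sequence_exact₃ L hS x rfl (hY.elim _ _)
  rw [Subsingleton.elim (α := Abelian.Ext L (ModuleCat.of R Z) a) y 0]
  exact Abelian.Ext.zero_comp ..

lemma sub_free (h : Subsingleton (Abelian.Ext L (ModuleCat.of R R) a)) (g : ℕ) :
    Subsingleton (Abelian.Ext L (ModuleCat.of R (Fin g → R)) a) :=
  subsingleton_of_forall_eq 0 fun x => push_pi_inj x fun _ => h.elim _ _

lemma sub_hom (h : Subsingleton (Abelian.Ext L (ModuleCat.of R Y) 0)) (f : L →ₗ[R] Y) : f = 0 := by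
  have h1 := (Abelian.Ext.addEquiv₀ (X := L) (Y := ModuleCat.of R Y)).symm.injective
    (h.elim (Abelian.Ext.addEquiv₀.symm (ModuleCat.ofHom f)) (Abelian.Ext.addEquiv₀.symm 0))
  simpa using congrArg ModuleCat.Hom.hom h1

/-- If `s` kills `L` then it kills `Ext L Y a`. -/
lemma smul_ext_eq_zero (s : R) (hs : ∀ x : L, s • x = 0) (N : ModuleCat R)
    (y : Abelian.Ext L N a) : s • y = 0 := by
  have h0 : s • (𝟙 L) = 0 := by
    refine ModuleCat.hom_ext (LinearMap.ext fun x => ?_)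
    exact hs x
  have : s • y = (Abelian.Ext.mk₀ (s • 𝟙 L)).comp y (zero_add a) := by
    rw [Abelian.Ext.mk₀_smul, Abelian.Ext.smul_comp, Abelian.Ext.mk₀_id_comp]
  rw [this, h0]
  simp

end

/-- Contravariant: if `Ext^{1}(W, N) = 0`, maps extend. -/
lemma extend_of_ext_one {Y Z W : Type} [AddCommGroup Y] [Module R Y] [AddCommGroup Z]
    [Module R Z] [AddCommGroup W] [Module R W] (N : ModuleCat R)
    (f : Y →ₗ[R] Z) (g : Z →ₗ[R] W) (hf : Function.Injective f)
    (hg : Function.Surjective g) (h : Function.Exact f g)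
    (hW : Subsingleton (Abelian.Ext (ModuleCat.of R W) N 1)) (φ : Y →ₗ[R] N) :
    ∃ ψ : Z →ₗ[R] N, ψ ∘ₗ f = φ := by
  have hS := ses f g hf hg h
  obtain ⟨x, hx⟩ := Abelian.Ext.contravariant_sequence_exact₁ hS (Y := N) (n₁ := 1)
    (Abelian.Ext.mk₀ (ModuleCat.ofHom φ : ModuleCat.of R Y ⟶ N)) rfl (hW.elim _ _)
  obtain ⟨ψ, rfl⟩ := Abelian.Ext.addEquiv₀.symm.surjective x
  refine ⟨ψ.hom, ?_⟩
  have h2 : (Abelian.Ext.mk₀ (ModuleCat.ofHom f ≫ ψ) : Abelian.Ext (ModuleCat.of R Y) N 0) =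
      Abelian.Ext.mk₀ (ModuleCat.ofHom φ : ModuleCat.of R Y ⟶ N) := by
    rw [← hx, ← Abelian.Ext.mk₀_comp_mk₀]
    rfl
  have h3 := (Abelian.Ext.addEquiv₀ (X := ModuleCat.of R Y) (Y := N)).symm.injective h2
  exact congrArg ModuleCat.Hom.hom h3

/-- Contravariant dimension shift. -/
lemma ext_shift {Y Z W : Type} [AddCommGroup Y] [Module R Y] [AddCommGroup Z]
    [Module R Z] [AddCommGroup W] [Module R W] [Module.Projective R Z] (N : ModuleCat R)
    (f : Y →ₗ[R] Z) (g : Z →ₗ[R] W) (hf : Function.Injective f)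
    (hg : Function.Surjective g) (h : Function.Exact f g) (n : ℕ)
    (hW : Subsingleton (Abelian.Ext (ModuleCat.of R W) N (n+2))) :
    Subsingleton (Abelian.Ext (ModuleCat.of R Y) N (n+1)) := by
  have hS := ses f g hf hg h
  refine subsingleton_of_forall_eq 0 fun y => ?_
  obtain ⟨x, hx⟩ := Abelian.Ext.contravariant_sequence_exact₁ hS N y (n₁ := n+2) (by lia) (hW.elim _ _)
  rw [← hx]
  have : Projective (ModuleCat.of R Z) := (IsProjective.iff_projective _).1 inferInstance
  rw [Abelian.Ext.eq_zero_of_projective x]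
  exact Abelian.Ext.comp_zero ..

end
end Aux7

namespace Aux7
section
variable {R}

/-- cokernel of a matrix -/
abbrev Cok {m n : ℕ} (A : Matrix (Fin m) (Fin n) R) : Type :=
  (Fin m → R) ⧸ LinearMap.range A.mulVecLin

/-- projection to the cokernel -/
def prj {m n : ℕ} (A : Matrix (Fin m) (Fin n) R) : (Fin m → R) →ₗ[R] Cok A :=
  (LinearMap.range A.mulVecLin).mkQ

/-- induced map from the cokernel -/
def emb {m n k : ℕ} (A : Matrix (Fin m) (Fin n) R) (B : Matrix (Fin n) (Fin k) R)
    (h : A * B = 0) : Cok B →ₗ[R] (Fin m → R) :=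
  (LinearMap.range B.mulVecLin).liftQ A.mulVecLin (by
    rintro _ ⟨x, rfl⟩
    simp [h])

section
variable {m n k : ℕ} {A : Matrix (Fin m) (Fin n) R} {B : Matrix (Fin n) (Fin k) R}

lemma mul_zero_of_exact (h : Function.Exact B.mulVecLin A.mulVecLin) : A * B = 0 := by
  have := h.linearMap_comp_eq_zero
  rw [← Matrix.mulVecLin_mul] at this
  apply Matrix.mulVec_injective
  funext x
  simpa using LinearMap.congr_fun this x

lemma prj_surj (A : Matrix (Fin m) (Fin n) R) : Function.Surjective (prj A) :=
  Submodule.mkQ_surjective _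

lemma emb_prj (h : A * B = 0) (x : Fin n → R) : emb A B h (prj B x) = A.mulVec x := rfl

lemma prj_eq_zero (x : Fin m → R) : prj A x = 0 ↔ ∃ y, A.mulVec y = x := by
  simp [prj]

lemma emb_inj (h : Function.Exact B.mulVecLin A.mulVecLin) :
    Function.Injective (emb A B (mul_zero_of_exact h)) := by
  rw [injective_iff_map_eq_zero]
  intro x hx
  obtain ⟨x, rfl⟩ := prj_surj B x
  rw [emb_prj] at hx
  obtain ⟨y, rfl⟩ := (h x).1 hx
  exact (prj_eq_zero _).2 ⟨y, rfl⟩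

lemma emb_exact (h : A * B = 0) : Function.Exact (emb A B h) (prj A) := by
  intro x
  rw [prj_eq_zero]
  constructor
  · rintro ⟨y, rfl⟩
    exact ⟨prj B y, rfl⟩
  · rintro ⟨y, rfl⟩
    obtain ⟨y, rfl⟩ := prj_surj B y
    exact ⟨y, rfl⟩

end

/-- A half-infinite exact complex of finite free modules. -/
structure Res (R : Type) [CommRing R] where
  g : ℕ → ℕ
  d : ∀ r, Matrix (Fin (g r)) (Fin (g (r+1))) R
  exact : ∀ r, Function.Exact (d (r+1)).mulVecLin (d r).mulVecLin

lemma Res.mul (P : Res R) (r : ℕ) : P.d r * P.d (r+1) = 0 := mul_zero_of_exact (P.exact r)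

/-- inclusion of a syzygy -/
def Res.ι (P : Res R) (r : ℕ) : Cok (P.d (r+1)) →ₗ[R] (Fin (P.g r) → R) := emb _ _ (P.mul r)

lemma Res.ι_inj (P : Res R) (r : ℕ) : Function.Injective (P.ι r) := emb_inj (P.exact r)

lemma Res.ι_exact (P : Res R) (r : ℕ) : Function.Exact (P.ι r) (prj (P.d r)) := emb_exact _

lemma exists_matrix {n : ℕ} (S : Submodule R (Fin n → R)) (hS : S.FG) :
    ∃ (k : ℕ) (B : Matrix (Fin n) (Fin k) R), LinearMap.range B.mulVecLin = S := by
  obtain ⟨k, s, hs⟩ := Submodule.fg_iff_exists_fin_generating_family.1 hS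
  refine ⟨k, Matrix.of fun i j => s j i, ?_⟩
  rw [Matrix.range_mulVecLin, ← hs]
  rfl

lemma exists_nxt [IsNoetherianRing R] {m n : ℕ} (A : Matrix (Fin m) (Fin n) R) :
    ∃ B : (Σ k : ℕ, Matrix (Fin n) (Fin k) R), Function.Exact B.2.mulVecLin A.mulVecLin := by
  obtain ⟨k, B, h⟩ := exists_matrix (LinearMap.ker A.mulVecLin) (IsNoetherian.noetherian _)
  exact ⟨⟨k, B⟩, LinearMap.exact_iff.2 h.symm⟩

/-- next matrix in a free resolution -/
def nxt [IsNoetherianRing R] {m n : ℕ} (A : Matrix (Fin m) (Fin n) R) :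
    Σ k : ℕ, Matrix (Fin n) (Fin k) R := (exists_nxt A).choose

/-- iterated matrices in a free resolution -/
def stRes [IsNoetherianRing R] {m n : ℕ} (A : Matrix (Fin m) (Fin n) R) :
    ℕ → Σ p : ℕ × ℕ, Matrix (Fin p.1) (Fin p.2) R
  | 0 => ⟨(m, n), A⟩
  | r+1 => ⟨((stRes A r).1.2, (nxt (stRes A r).2).1), (nxt (stRes A r).2).2⟩

/-- free resolution of the cokernel of a matrix -/
def mkRes [IsNoetherianRing R] {m n : ℕ} (A : Matrix (Fin m) (Fin n) R) : Res R where
  g r := (stRes A r).1.1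
  d r := (stRes A r).2
  exact r := (exists_nxt (stRes A r).2).choose_spec

lemma exists_pres [IsNoetherianRing R] (M : ModuleCat R) [Module.Finite R M] :
    ∃ (m n : ℕ) (A : Matrix (Fin m) (Fin n) R), Nonempty (M ≅ ModuleCat.of R (Cok A)) := by
  obtain ⟨m, f, hf⟩ := Module.Finite.exists_fin' R M
  obtain ⟨n, A, hA⟩ := exists_matrix (LinearMap.ker f) (IsNoetherian.noetherian _)
  refine ⟨m, n, A, ⟨?_⟩⟩
  refine LinearEquiv.toModuleIso (R := R) (X₁ := M) ?_
  exact ((Submodule.quotEquivOfEq _ _ hA).trans (f.quotKerEquivOfSurjective hf)).symm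

lemma synVan (P : Res R) (L : ModuleCat R) (c : ℕ)
    (hL : ∀ b < c, Subsingleton (Abelian.Ext L (ModuleCat.of R R) b)) :
    ∀ r a, a < c → a < r → Subsingleton (Abelian.Ext L (ModuleCat.of R (Cok (P.d r))) a)
  | 0, a, _, h => absurd h (by lia)
  | r+1, a, hc, hr => by
    refine sub_left (P.ι r) (prj (P.d r)) (P.ι_inj r) (prj_surj _) (P.ι_exact r) ?_
      (sub_free (hL a hc) _)
    intro b hb
    exact synVan P L c hL r b (by lia) (by lia)

end
end Aux7

namespace Aux7
section
variable {R}

lemma hv_of_ext (P : Res R) (L : ModuleCat R) (j : ℕ)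
    (hL : ∀ b < j, Subsingleton (Abelian.Ext L (ModuleCat.of R R) b))
    (y : Abelian.Ext L (ModuleCat.of R R) j) (q : Ideal R)
    (hq : ∀ r, r ∈ q ↔ r • y = 0) (r : ℕ) (hr : j ≤ r) (v : Cok (P.d (r+1)))
    (hv : ∀ i, P.ι r v i ∈ q) (φ : Cok (P.d (r+1)) →ₗ[R] R) : φ v ∈ q := by
  have key : ∀ (ψ : R →ₗ[R] R), push L j ψ y = ψ 1 • y := by
    intro ψ
    have : ψ = ψ 1 • LinearMap.id := by
      ext
      simp
    conv_lhs => rw [this, smul_push, push_id]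
  set f : R →ₗ[R] Cok (P.d (r+1)) := LinearMap.toSpanSingleton R _ v with hf
  have h0 : push L j f y = 0 := by
    refine push_injective (P.ι r) (prj (P.d r)) (P.ι_inj r) (prj_surj _) (P.ι_exact r) ?_ _ ?_
    · intro b hb
      exact synVan P L j hL r b (by lia) (by lia)
    · refine push_pi_inj _ fun i => ?_
      rw [← push_comp, ← push_comp, key]
      have := (hq _).1 (hv i)
      simpa [hf] using this
  have h1 : push L j (φ ∘ₗ f) y = 0 := by rw [push_comp, h0, push_zero]
  rw [key] at h1
  rw [hq]
  simpa [hf] using h1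

lemma qfree_syz (P : Res R) (L : ModuleCat R) (j : ℕ)
    (hL : ∀ b < j, Subsingleton (Abelian.Ext L (ModuleCat.of R R) b))
    (y : Abelian.Ext L (ModuleCat.of R R) j) (q : Ideal R) [q.IsPrime]
    (hq : ∀ r, r ∈ q ↔ r • y = 0) (r : ℕ) (hr : j ≤ r) :
    ∀ e t, QFree q t (Cok (P.d (r + e))) → ∃ t, QFree q t (Cok (P.d r))
  | 0, t, h => ⟨t, h⟩
  | e+1, t, h => by
    have : r + (e + 1) = (r + e) + 1 := by lia
    rw [this] at h
    obtain ⟨s, hs, ρ, hρ⟩ := QFree.exists_retraction (P.ι (r+e)) h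
      (fun v hv φ => hv_of_ext P L j hL y q hq (r+e) (by lia) v hv φ)
    exact qfree_syz P L j hL y q hq r hr e _
      (QFree.of_retraction (P.ι (r+e)) (prj _) (prj_surj _) (P.ι_exact _) hs ρ hρ)

/-- A finite projective module is QFree. -/
lemma qfree_of_projective (q : Ideal R) [hq : q.IsPrime] {m n : ℕ} (A : Matrix (Fin m) (Fin n) R)
    [Module.Projective R (Cok A)] : QFree q m (Cok A) := by
  obtain ⟨σ, hσ⟩ := Module.projective_lifting_property (prj A) LinearMap.id (prj_surj A)
  refine ⟨1, fun h => hq.ne_top ((Ideal.eq_top_iff_one _).2 h), σ,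
    fun i => prj A (Pi.single i 1), fun x => ?_⟩
  rw [one_smul]
  conv_lhs => rw [← LinearMap.id_apply (R := R) x, ← hσ, LinearMap.comp_apply,
    pi_eq_sum_univ' (σ x), map_sum]
  simp

lemma projective_of_qfree [IsLocalRing R] {t : ℕ} {S : Type} [AddCommGroup S] [Module R S]
    (h : QFree (IsLocalRing.maximalIdeal R) t S) : Module.Projective R S := by
  obtain ⟨s, hs, α, w, h⟩ := h
  have hu : IsUnit s := by simpa using hs
  obtain ⟨u, rfl⟩ := hu
  refine Module.Projective.of_split ((↑u⁻¹ : R) • α) (Fintype.linearCombination R w) ?_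
  refine LinearMap.ext fun x => ?_
  simp only [LinearMap.comp_apply, LinearMap.smul_apply, map_smul, LinearMap.id_apply,
    Fintype.linearCombination_apply]
  rw [← h, smul_smul]
  simp

lemma projective_mid {Y Z W : Type} [AddCommGroup Y] [Module R Y] [AddCommGroup Z]
    [Module R Z] [AddCommGroup W] [Module R W] [Module.Projective R Z]
    (f : Y →ₗ[R] Z) (g : Z →ₗ[R] W) (hf : Function.Injective f)
    (hg : Function.Surjective g) (h : Function.Exact f g) (ρ : Z →ₗ[R] Y)
    (hρ : ρ ∘ₗ f = LinearMap.id) : Module.Projective R W := by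
  have hk : LinearMap.range f ≤ LinearMap.ker (LinearMap.id - f ∘ₗ ρ) := by
    rintro _ ⟨y, rfl⟩
    have := LinearMap.congr_fun hρ y
    simp only [LinearMap.comp_apply, LinearMap.id_apply] at this
    simp [this]
  have hk2 : LinearMap.ker g ≤ LinearMap.ker (LinearMap.id - f ∘ₗ ρ) := by
    rw [h.linearMap_ker_eq]
    exact hk
  let e := g.quotKerEquivOfSurjective hg
  refine Module.Projective.of_split (((LinearMap.ker g).liftQ _ hk2) ∘ₗ e.symm.toLinearMap) g ?_
  refine LinearMap.ext fun w => ?_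
  obtain ⟨z, rfl⟩ := hg w
  have : e.symm (g z) = Submodule.Quotient.mk z := by
    rw [LinearEquiv.symm_apply_eq]
    rfl
  simp [this, h.apply_apply_eq_zero]

/-- projective syzygies are stable -/
lemma projective_succ (P : Res R) (r : ℕ) (h : Module.Projective R (Cok (P.d r))) :
    Module.Projective R (Cok (P.d (r+1))) := by
  obtain ⟨σ, hσ⟩ := Module.projective_lifting_property (prj (P.d r)) LinearMap.id (prj_surj _)
  have hk : ∀ z, ∃ y, P.ι r y = z - σ (prj (P.d r) z) := by
    intro z
    refine (P.ι_exact r _).1 ?_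
    have := LinearMap.congr_fun hσ (prj (P.d r) z)
    simp only [LinearMap.comp_apply, LinearMap.id_apply] at this
    simp [this]
  choose y hy using hk
  let ρ : (Fin (P.g r) → R) →ₗ[R] Cok (P.d (r+1)) :=
    { toFun := y
      map_add' := fun a b => P.ι_inj r (by simp only [map_add, hy]; abel)
      map_smul' := fun a b => P.ι_inj r (by simp only [map_smul, hy, smul_sub, RingHom.id_apply]) }
  refine Module.Projective.of_split (P.ι r) ρ ?_
  refine LinearMap.ext fun x => P.ι_inj r ?_
  have : prj (P.d r) (P.ι r x) = 0 := (P.ι_exact r).apply_apply_eq_zero x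
  change P.ι r (y (P.ι r x)) = _
  rw [hy, this]
  simp

lemma projective_of_le (P : Res R) (r e : ℕ) (h : Module.Projective R (Cok (P.d r))) :
    Module.Projective R (Cok (P.d (r+e))) := by
  induction e with
  | zero => exact h
  | succ e ih => exact projective_succ P _ ih

lemma ext_syz (P : Res R) (N : ModuleCat R) (i : ℕ) : ∀ r,
    Subsingleton (Abelian.Ext (ModuleCat.of R (Cok (P.d 0))) N (i + 1 + r)) →
    Subsingleton (Abelian.Ext (ModuleCat.of R (Cok (P.d r))) N (i + 1))
  | 0, h => h
  | r+1, h => by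
    refine ext_shift N (P.ι r) (prj _) (P.ι_inj r) (prj_surj _) (P.ι_exact r) i ?_
    have := ext_syz P N (i+1) r
    refine this ?_
    rwa [show i + 1 + 1 + r = i + 1 + (r+1) by lia]

lemma projective_of_ext (P : Res R) (p : ℕ)
    (h : ∀ N : ModuleCat R, Subsingleton (Abelian.Ext (ModuleCat.of R (Cok (P.d 0))) N (p+1))) :
    Module.Projective R (Cok (P.d p)) := by
  have h1 : ∀ N : ModuleCat R, Subsingleton (Abelian.Ext (ModuleCat.of R (Cok (P.d p))) N 1) := by
    intro N
    refine ext_syz P N 0 p ?_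
    rw [show 0 + 1 + p = p + 1 by lia]
    exact h N
  have : Projective (ModuleCat.of R (Cok (P.d p))) := by
    rw [projective_iff_subsingleton_ext_one]
    intro N
    exact h1 N
  exact (IsProjective.iff_projective _).2 this

end
end Aux7

namespace Aux7
section
variable {R}
open Matrix

lemma exists_factor {m n k l : ℕ} {D : Matrix (Fin m) (Fin n) R} {D' : Matrix (Fin n) (Fin k) R}
    (h : ∀ x, D *ᵥ x = 0 → ∃ y, D' *ᵥ y = x) (X : Matrix (Fin n) (Fin l) R) (hX : D * X = 0) :
    ∃ Y : Matrix (Fin k) (Fin l) R, D' * Y = X := by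
  have h1 : ∀ j, ∃ y, D' *ᵥ y = X.col j := by
    intro j
    apply h
    funext i
    exact congrFun (congrFun hX i) j
  choose y hy using h1
  refine ⟨Matrix.of fun i j => y j i, ?_⟩
  ext i j
  exact congrFun (hy j) i

lemma reg_of_qfree {m n t : ℕ} (D : Matrix (Fin m) (Fin n) R) (s : R)
    (α : Cok D →ₗ[R] (Fin t → R)) (w : Fin t → Cok D) (h : ∀ x, s • x = ∑ i, α x i • w i) :
    ∃ C : Matrix (Fin n) (Fin m) R, D * C * D = s • D := by
  choose w' hw using fun i => prj_surj D (w i)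
  let ρ : (Fin m → R) →ₗ[R] (Fin m → R) :=
    s • LinearMap.id - (Fintype.linearCombination R w') ∘ₗ α ∘ₗ prj D
  have hρ : ∀ u, ρ u = s • u - ∑ i, α (prj D u) i • w' i := by
    intro u
    simp [ρ, Fintype.linearCombination_apply]
  have h1 : ∀ u, ∃ y, D *ᵥ y = ρ u := by
    intro u
    rw [← prj_eq_zero, hρ, map_sub, map_smul, h, map_sum]
    simp [hw]
  choose c hc using fun i : Fin m => h1 (Pi.single i 1)
  have e : D * Matrix.of (fun i j => c j i) = LinearMap.toMatrix' ρ := by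
    ext i j
    rw [LinearMap.toMatrix'_apply]
    have := congrFun (hc j) i
    exact this
  refine ⟨Matrix.of fun i j => c j i, ?_⟩
  rw [e]
  apply Matrix.mulVec_injective
  funext x
  rw [← Matrix.mulVec_mulVec, LinearMap.toMatrix'_mulVec, hρ,
    (prj_eq_zero (A := D) _).2 ⟨x, rfl⟩, Matrix.smul_mulVec]
  simp

lemma reg_of_projective {m n : ℕ} (D : Matrix (Fin m) (Fin n) R)
    (h : Module.Projective R (Cok D)) : ∃ C : Matrix (Fin n) (Fin m) R, D * C * D = D := by
  obtain ⟨σ, hσ⟩ := Module.projective_lifting_property (prj D) LinearMap.id (prj_surj D)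
  obtain ⟨C, hC⟩ := reg_of_qfree D 1 σ (fun i => prj D (Pi.single i 1)) (fun x => by
    rw [one_smul]
    conv_lhs => rw [← LinearMap.id_apply (R := R) x, ← hσ, LinearMap.comp_apply,
      pi_eq_sum_univ' (σ x), map_sum]
    simp)
  exact ⟨C, by rw [hC, one_smul]⟩

lemma projective_of_reg {m n : ℕ} (D : Matrix (Fin m) (Fin n) R) (C : Matrix (Fin n) (Fin m) R)
    (h : D * C * D = D) :
    Module.Projective R (Cok D) := by
  refine Module.Projective.of_split ((LinearMap.range D.mulVecLin).liftQ (1 - D * C).mulVecLin ?_)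
    (prj D) ?_
  · rintro _ ⟨x, rfl⟩
    simp only [Matrix.mulVecLin_apply, LinearMap.mem_ker, Matrix.mulVec_mulVec, Matrix.sub_mul,
      Matrix.one_mul, h, sub_self, Matrix.zero_mulVec]
  · refine LinearMap.ext fun x => ?_
    obtain ⟨x, rfl⟩ := prj_surj D x
    change prj D ((1 - D * C) *ᵥ x) = prj D x
    rw [Matrix.sub_mulVec, map_sub, Matrix.one_mulVec, ← Matrix.mulVec_mulVec,
      (prj_eq_zero (A := D) (D *ᵥ (C *ᵥ x))).2 ⟨_, rfl⟩, sub_zero]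

lemma reg_transpose {m n : ℕ} {D : Matrix (Fin m) (Fin n) R} (h : ∃ C : Matrix (Fin n) (Fin m) R, D * C * D = D) :
    ∃ C : Matrix (Fin m) (Fin n) R, Dᵀ * C * Dᵀ = Dᵀ := by
  obtain ⟨C, h⟩ := h
  refine ⟨Cᵀ, ?_⟩
  conv_rhs => rw [← h]
  simp [Matrix.mul_assoc]

/-- dual exactness at spot `r+1`. -/
def DE (P : Res R) (r : ℕ) : Prop :=
  ∀ z, (P.d (r+1))ᵀ *ᵥ z = 0 → ∃ y, (P.d r)ᵀ *ᵥ y = z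

lemma reg_down (P : Res R) (r : ℕ) (hDE : DE P r)
    (h : ∃ C : Matrix (Fin (P.g (r+1 + 1))) (Fin (P.g (r+1))) R, P.d (r+1) * C * P.d (r+1) = P.d (r+1)) :
    ∃ C : Matrix (Fin (P.g (r + 1))) (Fin (P.g r)) R, P.d r * C * P.d r = P.d r := by
  obtain ⟨C, h⟩ := h
  obtain ⟨B, hB⟩ := exists_factor hDE (1 - Cᵀ * (P.d (r+1))ᵀ) (by
    rw [Matrix.mul_sub, Matrix.mul_one]
    conv_lhs => enter [1]; rw [← h]
    simp [Matrix.mul_assoc])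
  have hB' := congrArg Matrix.transpose hB
  simp only [Matrix.transpose_mul, Matrix.transpose_transpose, Matrix.transpose_sub,
    Matrix.transpose_one] at hB'
  refine ⟨Bᵀ, ?_⟩
  rw [Matrix.mul_assoc, hB', Matrix.mul_sub, ← Matrix.mul_assoc, P.mul]
  simp

lemma reg_zero (P : Res R) : ∀ n, (∀ r < n, DE P r) →
    (∃ C : Matrix (Fin (P.g (n + 1))) (Fin (P.g n)) R, P.d n * C * P.d n = P.d n) → ∃ C : Matrix (Fin (P.g (0 + 1))) (Fin (P.g 0)) R, P.d 0 * C * P.d 0 = P.d 0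
  | 0, _, h => h
  | n+1, hd, h => reg_zero P n (fun r hr => hd r (by lia)) (reg_down P n (hd n (by lia)) h)

lemma dual_kill (P : Res R) (r : ℕ) (s : R) (C : Matrix (Fin (P.g (r + 1))) (Fin (P.g r)) R)
    (hC : P.d r * C * P.d r = s • P.d r)
    (z) (hz : (P.d (r+1))ᵀ *ᵥ z = 0) : ∃ y, (P.d r)ᵀ *ᵥ y = s • z := by
  obtain ⟨Y, hY⟩ := exists_factor (D := P.d r) (D' := P.d (r+1))
    (fun x hx => (P.exact r x).1 hx) (C * P.d r - s • 1) (by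
      rw [Matrix.mul_sub, ← Matrix.mul_assoc, hC]; simp)
  have hY' := congrArg (fun X => Xᵀ *ᵥ z) hY
  simp only [Matrix.transpose_mul, Matrix.transpose_sub, Matrix.transpose_smul,
    Matrix.transpose_one, ← Matrix.mulVec_mulVec, hz, Matrix.mulVec_zero, Matrix.sub_mulVec,
    Matrix.smul_mulVec, Matrix.one_mulVec] at hY'
  exact ⟨Cᵀ *ᵥ z, (sub_eq_zero.1 hY'.symm)⟩

lemma dual_mul (P : Res R) (r : ℕ) : (P.d (r+1))ᵀ * (P.d r)ᵀ = 0 := by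
  rw [← Matrix.transpose_mul, P.mul, Matrix.transpose_zero]

/-- vanishing property -/
def QV (P : Res R) (n r : ℕ) : Prop :=
  ∀ (L : ModuleCat R) (c : ℕ), (∀ b < c, Subsingleton (Abelian.Ext L (ModuleCat.of R R) b)) →
    ∀ a, a + r + 1 ≤ c → a + r + 1 ≤ n →
      Subsingleton (Abelian.Ext L (ModuleCat.of R (Cok (P.d r)ᵀ)) a)

lemma DE_step [IsNoetherianRing R] (P : Res R) (p : ℕ) (hp : Module.Projective R (Cok (P.d p)))
    (n r : ℕ) (hr : r < n) (hQ : QV P n r) : DE P r := by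
  set f := emb (P.d (r+1))ᵀ (P.d r)ᵀ (dual_mul P r) with hf
  let E := LinearMap.ker f
  have hE : ∀ j < r + 1, Subsingleton (Abelian.Ext (ModuleCat.of R E) (ModuleCat.of R R) j) := by
    intro j
    induction j using Nat.strong_induction_on with
    | _ j ih =>
    intro hj
    by_contra hns
    rw [not_subsingleton_iff_nontrivial] at hns
    obtain ⟨q, hq⟩ := associatedPrimes.nonempty R
      (Abelian.Ext (ModuleCat.of R E) (ModuleCat.of R R) j)
    obtain ⟨hqp, f, hfi⟩ := (isAssociatedPrime_iff_exists_injective_linearMap _ _).1 hq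
    let y := f 1
    have hq' : ∀ x, x ∈ q ↔ x • y = 0 := by
      intro x
      rw [← map_smul, map_eq_zero_iff f hfi, ← Ideal.Quotient.eq_zero_iff_mem, Algebra.smul_def,
        mul_one]
      rfl
    have hpp : Module.Projective R (Cok (P.d (r + p))) := by
      rw [add_comm]; exact projective_of_le P p r hp
    obtain ⟨t, s, hs, α, w, h⟩ := qfree_syz P (ModuleCat.of R E) j
      (fun b hb => ih b hb (by lia)) y q hq' r (by lia) p _ (qfree_of_projective q _)
    obtain ⟨C, hC⟩ := reg_of_qfree _ s α w h
    refine hs ((hq' s).2 (smul_ext_eq_zero s ?_ _ y))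
    rintro ⟨x, hx⟩
    refine Subtype.ext ?_
    change s • x = 0
    obtain ⟨z, rfl⟩ := prj_surj _ x
    rw [← map_smul, prj_eq_zero]
    exact dual_kill P r s C hC z hx
  have h0 := sub_hom (hQ (ModuleCat.of R E) (r+1) hE 0 (by lia) (by lia)) E.subtype
  intro z hz
  rw [← prj_eq_zero]
  exact LinearMap.congr_fun h0 (⟨prj (P.d r)ᵀ z, hz⟩ : E)

lemma DE_all [IsNoetherianRing R] (P : Res R) (p : ℕ) (hp : Module.Projective R (Cok (P.d p)))
    (n : ℕ) (hQ : QV P n 0) : ∀ r < n, DE P r := by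
  have hQr : ∀ r < n, QV P n r := by
    intro r
    induction r with
    | zero => exact fun _ => hQ
    | succ r ih =>
      intro hr L c hL a hac han
      have hQ' := ih (by lia)
      have hDE := DE_step P p hp n r (by lia) hQ'
      refine sub_right (emb (P.d (r+1))ᵀ (P.d r)ᵀ (dual_mul P r)) (prj _) ?_ (prj_surj _)
        (emb_exact _) (hQ' L c hL (a+1) (by lia) (by lia)) (sub_free (hL a (by lia)) _)
      rw [injective_iff_map_eq_zero]
      intro x hx
      obtain ⟨z, rfl⟩ := prj_surj _ x
      exact (prj_eq_zero _).2 (hDE z hx)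
  exact fun r hr => DE_step P p hp n r hr (hQr r hr)

end
end Aux7

namespace Aux7
section
variable {R}
open Matrix TensorProduct

/-- Every map factors through a finite free module. -/
def Fac (X : Type) [AddCommGroup X] [Module R X] (N : ModuleCat R) : Prop :=
  ∀ g : X →ₗ[R] N, ∃ (t : ℕ) (φ : X →ₗ[R] (Fin t → R)) (w : Fin t → N),
    ∀ x, g x = ∑ l, φ x l • w l

lemma tor_of_fac {m k : ℕ} (A : Matrix (Fin m) (Fin k) R) (N : ModuleCat R)
    (h : Fac (Cok A) N) : Subsingleton (tor R 1 N (ModuleCat.of R (Cok Aᵀ))) := by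
  refine tor_one_vanish N (ModuleCat.of R (Cok Aᵀ)) (prj Aᵀ) (prj_surj _) ?_
  let a : (Fin m → R) →ₗ[R] LinearMap.ker (prj Aᵀ) :=
    LinearMap.codRestrict _ Aᵀ.mulVecLin (fun x => (prj_eq_zero _).2 ⟨x, rfl⟩)
  have ha : Function.Surjective a := by
    rintro ⟨x, hx⟩
    obtain ⟨y, rfl⟩ := (prj_eq_zero _).1 hx
    exact ⟨y, rfl⟩
  rw [injective_iff_map_eq_zero]
  intro z hz
  obtain ⟨u, rfl⟩ := LinearMap.lTensor_surjective N ha z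
  rw [← LinearMap.comp_apply, ← LinearMap.lTensor_comp] at hz
  change (LinearMap.lTensor N Aᵀ.mulVecLin) u = 0 at hz
  have hu : ∃ ν : Fin m → N, u = ∑ i, ν i ⊗ₜ[R] (Pi.single i 1 : Fin m → R) := by
    refine ⟨TensorProduct.piScalarRight R R N (Fin m) u, ?_⟩
    apply (TensorProduct.piScalarRight R R N (Fin m)).injective
    rw [map_sum]
    funext i
    simp [Pi.single_apply]
  obtain ⟨ν, rfl⟩ := hu
  have hA : ∀ j, ∑ i, A i j • ν i = 0 := by
    intro j
    have := congrFun (congrArg (TensorProduct.piScalarRight R R N (Fin k)) hz) j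
    simpa [map_sum, Finset.sum_apply] using this
  let g0 : (Fin m → R) →ₗ[R] N := Fintype.linearCombination R ν
  let g : Cok A →ₗ[R] N := (LinearMap.range A.mulVecLin).liftQ g0 (by
    rintro _ ⟨y, rfl⟩
    rw [LinearMap.mem_ker, Fintype.linearCombination_apply]
    simp only [Matrix.mulVecLin_apply, Matrix.mulVec, dotProduct, Finset.sum_smul]
    rw [Finset.sum_comm]
    refine Finset.sum_eq_zero fun j _ => ?_
    simp only [mul_comm _ (y j), mul_smul]
    rw [← Finset.smul_sum, hA, smul_zero])
  obtain ⟨t, φ, w, hφ⟩ := h g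
  have hν : ∀ i, ν i = ∑ l, φ (prj A (Pi.single i 1)) l • w l := by
    intro i
    rw [← hφ]
    change _ = g0 _
    simp [g0]
  have e : ∑ i, ν i ⊗ₜ[R] (Pi.single i 1 : Fin m → R) =
      ∑ l, w l ⊗ₜ[R] (∑ i, φ (prj A (Pi.single i 1)) l • (Pi.single i 1 : Fin m → R)) := by
    simp only [TensorProduct.tmul_sum, TensorProduct.tmul_smul]
    rw [Finset.sum_comm]
    refine Finset.sum_congr rfl fun i _ => ?_
    conv_lhs => rw [hν i, TensorProduct.sum_tmul]
    simp only [TensorProduct.smul_tmul']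
  rw [e, map_sum]
  refine Finset.sum_eq_zero fun l _ => ?_
  rw [LinearMap.lTensor_tmul]
  have : a (∑ i, φ (prj A (Pi.single i 1)) l • (Pi.single i 1 : Fin m → R)) = 0 := by
    refine Subtype.ext ?_
    change Aᵀ *ᵥ _ = 0
    have h1 : (∑ i, φ (prj A (Pi.single i 1)) l • (Pi.single i 1 : Fin m → R)) =
        fun i => φ (prj A (Pi.single i 1)) l := by
      rw [← pi_eq_sum_univ' (fun i => φ (prj A (Pi.single i 1)) l)]
    rw [h1]
    funext j
    have h2 : φ (prj A (A *ᵥ Pi.single j 1)) l = 0 := by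
      rw [(prj_eq_zero (A := A) _).2 ⟨_, rfl⟩, map_zero]; rfl
    rw [Matrix.mulVec_single_one, pi_eq_sum_univ' (A.col j)] at h2
    simpa [map_sum, Matrix.mulVec, dotProduct, Finset.sum_apply] using h2
  rw [this, TensorProduct.tmul_zero]

lemma fac_syz (F : Res R) (N : ModuleCat R) : ∀ n,
    Subsingleton (Abelian.Ext (ModuleCat.of R (Cok (F.d 0))) N n) → Fac (Cok (F.d n)) N
  | 0, h => by
    intro g
    refine ⟨0, 0, 0, fun x => ?_⟩
    have := sub_hom (L := ModuleCat.of R (Cok (F.d 0))) (Y := N) h g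
    simp [this]
  | n+1, h => by
    intro g
    have h1 := ext_syz F N 0 n (by rwa [show 0 + 1 + n = n + 1 by lia])
    obtain ⟨ψ, hψ⟩ := extend_of_ext_one N (F.ι n) (prj _) (F.ι_inj n) (prj_surj _) (F.ι_exact n) h1 g
    refine ⟨_, F.ι n, fun i => ψ (Pi.single i 1), fun x => ?_⟩
    conv_lhs => rw [← hψ, LinearMap.comp_apply, pi_eq_sum_univ' (F.ι n x), map_sum]
    simp

lemma exists_depth [IsLocalRing R] (n : ℕ) (hn : depth R (ModuleCat.of R R) ≤ (n : ℕ∞)) :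
    ∃ d ≤ n, ¬ Subsingleton (Abelian.Ext (ModuleCat.of R (IsLocalRing.ResidueField R))
      (ModuleCat.of R R) d) := by
  unfold depth at hn
  have hne : {n : ℕ∞ | ∃ i : ℕ, n = i ∧ ¬ Subsingleton
      (ext R i (ModuleCat.of R (IsLocalRing.ResidueField R)) (ModuleCat.of R R))}.Nonempty := by
    by_contra hc
    rw [Set.not_nonempty_iff_eq_empty] at hc
    rw [hc, sInf_empty] at hn
    exact absurd hn (by simp)
  obtain ⟨i, hi, hi'⟩ := csInf_mem hne
  rw [hi] at hn
  refine ⟨i, by exact_mod_cast hn, ?_⟩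
  rwa [← ext_iff]

lemma projective_depth [IsLocalRing R] (n : ℕ)
    (hn : depth R (ModuleCat.of R R) ≤ (n : ℕ∞)) (P : Res R) (p : ℕ)
    (hp : Module.Projective R (Cok (P.d p))) : Module.Projective R (Cok (P.d n)) := by
  classical
  have hex := exists_depth n hn
  have hex2 : ∃ d, ¬ Subsingleton (Abelian.Ext (ModuleCat.of R (IsLocalRing.ResidueField R))
      (ModuleCat.of R R) d) := hex.imp fun _ h => h.2
  have hd := Nat.find_spec hex2
  have hmin := fun m => Nat.find_min (m := m) hex2
  have hdn : Nat.find hex2 ≤ n := by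
    obtain ⟨d, h1, h2⟩ := hex
    exact (Nat.find_min' hex2 h2).trans h1
  generalize Nat.find hex2 = d at *
  rw [not_subsingleton_iff_nontrivial] at hd
  obtain ⟨y, hy⟩ := exists_ne (0 : Abelian.Ext (ModuleCat.of R (IsLocalRing.ResidueField R))
      (ModuleCat.of R R) d)
  have hq : ∀ r, r ∈ IsLocalRing.maximalIdeal R ↔ r • y = 0 := by
    intro r
    constructor
    · intro hr
      refine smul_ext_eq_zero r (fun x => ?_) _ y
      change r • (x : IsLocalRing.ResidueField R) = 0
      rw [Algebra.smul_def, IsLocalRing.ResidueField.algebraMap_eq,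
        (IsLocalRing.residue_eq_zero_iff r).2 hr, zero_mul]
    · intro hr
      by_contra hc
      have hu : IsUnit r := by simpa using hc
      exact hy ((hu.smul_eq_zero).1 hr)
  have hpp : Module.Projective R (Cok (P.d (n + p))) := by
    rw [add_comm]; exact projective_of_le P p n hp
  obtain ⟨t, ht⟩ := qfree_syz P _ d (fun b hb => not_not.1 (hmin b hb)) y _ hq n hdn p _
    (qfree_of_projective _ _)
  exact projective_of_qfree ht

lemma exists_proj_of_projDim (P : Res R)
    (h : projDim R (ModuleCat.of R (Cok (P.d 0))) < ⊤) :
    ∃ p, Module.Projective R (Cok (P.d p)) := by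
  unfold projDim at h
  obtain ⟨c, hc, hc'⟩ := sInf_lt_iff.1 h
  lift c to ℕ using hc'.ne
  refine ⟨c, projective_of_ext P c fun N => ?_⟩
  rw [← ext_iff]
  exact hc (c+1) N (by exact_mod_cast Nat.lt_succ_self c)

lemma main_dual [IsNoetherianRing R] [IsLocalRing R] (N : ModuleCat R) (hsr : StronglyRigid R N)
    (n : ℕ) (hn : depth R (ModuleCat.of R R) ≤ (n : ℕ∞)) (P : Res R) (hQ : QV P n 0)
    (hF : Fac (Cok (P.d 0)ᵀ) N) : Module.Projective R (Cok (P.d 0)ᵀ) := by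
  have ht := tor_of_fac _ N hF
  rw [Matrix.transpose_transpose] at ht
  obtain ⟨p, hp⟩ := exists_proj_of_projDim P
    (hsr (ModuleCat.of R (Cok (P.d 0))) (inferInstanceAs (Module.Finite R (Cok (P.d 0)))) 1 le_rfl ht)
  have h1 := projective_depth n hn P p hp
  obtain ⟨C, hC⟩ := reg_transpose (reg_zero P n (DE_all P p hp n hQ) (reg_of_projective _ h1))
  exact projective_of_reg _ C hC

lemma main_syz [IsNoetherianRing R] [IsLocalRing R] (N : ModuleCat R) (hsr : StronglyRigid R N)
    (n : ℕ) (hn : depth R (ModuleCat.of R R) ≤ (n : ℕ∞)) (F : Res R)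
    (h : Subsingleton (Abelian.Ext (ModuleCat.of R (Cok (F.d 0))) N n)) :
    Module.Projective R (Cok (F.d n)) := by
  refine main_dual N hsr n hn (mkRes (F.d n)ᵀ) ?_ (fac_syz F N n h)
  intro L c hL a hac han
  exact synVan F L c hL n a (by lia) (by lia)

end
end Aux7

namespace Aux7
section
variable {R}

lemma ext_shift_up {Y Z W : Type} [AddCommGroup Y] [Module R Y] [AddCommGroup Z]
    [Module R Z] [AddCommGroup W] [Module R W] [Module.Projective R Z] (N : ModuleCat R)
    (f : Y →ₗ[R] Z) (g : Z →ₗ[R] W) (hf : Function.Injective f)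
    (hg : Function.Surjective g) (h : Function.Exact f g) (n : ℕ)
    (hY : Subsingleton (Abelian.Ext (ModuleCat.of R Y) N (n+1))) :
    Subsingleton (Abelian.Ext (ModuleCat.of R W) N (n+2)) := by
  have hS := ses f g hf hg h
  refine subsingleton_of_forall_eq 0 fun y => ?_
  have : Projective (ModuleCat.of R Z) := (IsProjective.iff_projective _).1 inferInstance
  obtain ⟨x, hx⟩ := Abelian.Ext.contravariant_sequence_exact₃ hS N y
    (Abelian.Ext.eq_zero_of_projective (P := ModuleCat.of R Z) (n := n+1) _) (n₀ := n+1) (by lia)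
  rw [← hx, Subsingleton.elim (α := Abelian.Ext (ModuleCat.of R Y) N (n+1)) x 0]
  exact Abelian.Ext.comp_zero ..

lemma ext_vanish_of_projective (F : Res R) (N : ModuleCat R) : ∀ p i,
    Subsingleton (Abelian.Ext (ModuleCat.of R (Cok (F.d p))) N (i+1)) →
    Subsingleton (Abelian.Ext (ModuleCat.of R (Cok (F.d 0))) N (i+1+p))
  | 0, i, h => h
  | p+1, i, h => by
    have := ext_vanish_of_projective F N p (i+1) (ext_shift_up N (F.ι p) (prj _) (F.ι_inj p)
      (prj_surj _) (F.ι_exact p) i h)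
    rwa [show i + 1 + (p+1) = i + 1 + 1 + p by lia]

lemma exists_not_mem [IsLocalRing R] (N : ModuleCat R) [Module.Finite R N] (hN : Nontrivial N) :
    ∃ x : N, x ∉ (IsLocalRing.maximalIdeal R • ⊤ : Submodule R N) := by
  by_contra! hc
  have h1 : (⊤ : Submodule R N) ≤ IsLocalRing.maximalIdeal R • ⊤ := fun x _ => hc x
  have := Submodule.eq_bot_of_le_smul_of_le_jacobson_bot _ _ Module.Finite.fg_top h1
    (IsLocalRing.maximalIdeal_le_jacobson _)
  exact top_ne_bot this

lemma projective_pred [IsLocalRing R] (F : Res R) (N : ModuleCat R) [Module.Finite R N]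
    (hN : Nontrivial N) (p : ℕ)
    (h : Subsingleton (Abelian.Ext (ModuleCat.of R (Cok (F.d 0))) N (p+1)))
    (hp : Module.Projective R (Cok (F.d (p+1)))) : Module.Projective R (Cok (F.d p)) := by
  obtain ⟨n0, hn0⟩ := exists_not_mem N hN
  have h1 := ext_syz F N 0 p (by rwa [show 0 + 1 + p = p + 1 by lia])
  obtain ⟨s, hs, ρ, hρ⟩ := QFree.exists_retraction (q := IsLocalRing.maximalIdeal R) (F.ι p)
    (qfree_of_projective _ _) (by
      intro v hv φ
      obtain ⟨ψ, hψ⟩ := extend_of_ext_one N (F.ι p) (prj _) (F.ι_inj p) (prj_surj _)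
        (F.ι_exact p) h1 (LinearMap.toSpanSingleton R N n0 ∘ₗ φ)
      have e := LinearMap.congr_fun hψ v
      simp only [LinearMap.comp_apply, LinearMap.toSpanSingleton_apply] at e
      by_contra hc
      have hu : IsUnit (φ v) := by simpa using hc
      apply hn0
      have hm : φ v • n0 ∈ (IsLocalRing.maximalIdeal R • ⊤ : Submodule R N) := by
        rw [← e, pi_eq_sum_univ' (F.ι p v), map_sum]
        refine Submodule.sum_mem _ fun i _ => ?_
        rw [map_smul]
        exact Submodule.smul_mem_smul (hv i) trivial
      obtain ⟨u, hu⟩ := hu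
      rw [← hu] at hm
      have := Submodule.smul_mem _ (↑u⁻¹ : R) hm
      rwa [smul_smul, Units.inv_mul, one_smul] at this)
  exact projective_of_qfree (QFree.of_retraction (F.ι p) (prj _) (prj_surj _) (F.ι_exact p) hs ρ hρ)

lemma hom_nonzero [IsLocalRing R] {m n : ℕ} (A : Matrix (Fin m) (Fin n) R) (N : ModuleCat R)
    (hN : Nontrivial N) (hA : Nontrivial (Cok A)) (hp : Module.Projective R (Cok A)) :
    ¬ Subsingleton (Abelian.Ext (ModuleCat.of R (Cok A)) N 0) := by
  intro h
  obtain ⟨x, hx⟩ := exists_ne (0 : N)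
  have hfree : Module.Free R (Cok A) := Module.free_of_flat_of_isLocalRing
  let b := Module.Free.chooseBasis R (Cok A)
  obtain ⟨i⟩ := b.index_nonempty
  have := sub_hom (L := ModuleCat.of R (Cok A)) (Y := N) h (b.constr R (fun _ => x))
  apply hx
  have e := LinearMap.congr_fun this (b i)
  rwa [Module.Basis.constr_basis] at e

/-- main statement in terms of a resolution -/
lemma main_res [IsNoetherianRing R] [IsLocalRing R] (F : Res R)
    (N : ModuleCat R) [Module.Finite R N] (hM : Nontrivial (Cok (F.d 0)))
    (hN : Nontrivial N) (hsr : StronglyRigid R N)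
    (n : ℕ) (hn : depth R (ModuleCat.of R R) ≤ (n : ℕ∞))
    (h : Subsingleton (Abelian.Ext (ModuleCat.of R (Cok (F.d 0))) N n)) :
    ∃ p < n, ¬ Subsingleton (Abelian.Ext (ModuleCat.of R (Cok (F.d 0))) N p) ∧
      ∀ i, p < i → ∀ X : ModuleCat R,
        Subsingleton (Abelian.Ext (ModuleCat.of R (Cok (F.d 0))) X i) := by
  classical
  have hpn := main_syz N hsr n hn F h
  have hex : ∃ p, Module.Projective R (Cok (F.d p)) := ⟨n, hpn⟩
  have hp := Nat.find_spec hex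
  have hmin := fun m => Nat.find_min (m := m) hex
  have hle := Nat.find_min' hex hpn
  generalize Nat.find hex = p at *
  have hne : ¬ Subsingleton (Abelian.Ext (ModuleCat.of R (Cok (F.d 0))) N p) := by
    cases p with
    | zero => exact hom_nonzero _ N hN hM hp
    | succ p =>
      intro hs
      exact hmin p (Nat.lt_succ_self p) (projective_pred F N hN p hs hp)
  refine ⟨p, lt_of_le_of_ne hle fun e => hne (e ▸ h), hne, fun i hi X => ?_⟩
  obtain ⟨e, rfl⟩ : ∃ e, i = e + 1 + p := ⟨i - p - 1, by lia⟩
  refine ext_vanish_of_projective F X p e ?_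
  have : Projective (ModuleCat.of R (Cok (F.d p))) := (IsProjective.iff_projective _).1 hp
  exact subsingleton_of_forall_eq 0 fun x => Abelian.Ext.eq_zero_of_projective x

lemma ext_iso {M M' : ModuleCat R} (e : M ≅ M') (N : ModuleCat R) (i : ℕ) :
    Subsingleton (ext R i M N) ↔ Subsingleton (Abelian.Ext M' N i) := by
  rw [← ext_iff]
  exact ((((Ext R (ModuleCat R) i).mapIso e.op).app N).toLinearEquiv).toEquiv.subsingleton_congr.symm

end
end Aux7

/-- if `N` is strongly-rigid and `Ext^n_R(M,N) = 0` for some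
`n ≥ depth R`, then `pd M ≤ n - 1` and `pd M = sup {i | Ext^i(M,N) ≠ 0}`. -/
theorem stmt7 [IsNoetherianRing R] [IsLocalRing R]
    (M N : ModuleCat R) [Module.Finite R M] [Module.Finite R N]
    (hM : Nontrivial M) (hN : Nontrivial N) (hsr : StronglyRigid R N)
    (n : ℕ) (hn : depth R (ModuleCat.of R R) ≤ (n : ℕ∞))
    (h : Subsingleton (ext R n M N)) :
    projDim R M < (n : ℕ∞) ∧
    projDim R M = sSup {i : ℕ∞ | ∃ j : ℕ, i = j ∧ ¬ Subsingleton (ext R j M N)} := by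
  obtain ⟨m, k, A, ⟨e⟩⟩ := Aux7.exists_pres M
  have hM' : Nontrivial (Aux7.Cok A) := e.toLinearEquiv.toEquiv.nontrivial_congr.1 hM
  obtain ⟨p, hpn, hp, hv⟩ := Aux7.main_res (Aux7.mkRes A) N hM' hN hsr n hn
    ((Aux7.ext_iso e N n).1 h)
  have hp' : ¬ Subsingleton (ext R p M N) := fun hh => hp ((Aux7.ext_iso e N p).1 hh)
  have hv' : ∀ i, p < i → ∀ X : ModuleCat R, Subsingleton (ext R i M X) :=
    fun i hi X => (Aux7.ext_iso e X i).2 (hv i hi X)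
  have hpd : projDim R M = p := by
    refine le_antisymm (sInf_le fun i X hi => hv' i (by exact_mod_cast hi) X) (le_sInf ?_)
    intro c hc
    by_contra hlt
    exact hp' (hc p N (not_le.1 hlt))
  have hsup : sSup {i : ℕ∞ | ∃ j : ℕ, i = j ∧ ¬ Subsingleton (ext R j M N)} = p := by
    refine le_antisymm (sSup_le ?_) (le_sSup ⟨p, rfl, hp'⟩)
    rintro _ ⟨j, rfl, hj⟩
    by_contra hlt
    exact hj (hv' j (by exact_mod_cast not_le.1 hlt) N)
  rw [hpd, hsup]
  exact ⟨by exact_mod_cast hpn, rfl⟩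
end
end

section
/- Let (R, m) be a commutative Noetherian local ring, and let M and N be nonzero finitely generated R-modules. Assume N is a rigid-test module (Tor-rigid and a test module for projectivity) and Ext^n_R(M,N) = 0 for some integer n ≥ depth(N). Then pd(M) ≤ n - 1, and pd(M) = sup{i : Ext^i_R(M,N) ≠ 0}. -/
open CategoryTheory

noncomputable section

variable (R : Type) [CommRing R]

section Part1

variable {R}

def prπ {Z : ModuleCat.{0} R} (P : ProjectiveResolution Z) : P.complex.X 0 ⟶ Z := P.π.f 0

lemma d_prπ {Z : ModuleCat.{0} R} (P : ProjectiveResolution Z) :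
    P.complex.d 1 0 ≫ prπ P = 0 := P.complex_d_comp_π_f_zero

lemma exact_prπ {Z : ModuleCat.{0} R} (P : ProjectiveResolution Z) :
    Function.Exact (P.complex.d 1 0) (prπ P) :=
  (ShortComplex.ShortExact.moduleCat_exact_iff_function_exact _).1 P.exact₀

lemma surj_prπ {Z : ModuleCat.{0} R} (P : ProjectiveResolution Z) :
    Function.Surjective (prπ P) := by
  have : Epi (P.π.f 0) := inferInstance
  exact (ModuleCat.epi_iff_surjective _).1 this

variable (R) in
open CategoryTheory.Abelian in
lemma ext_sub_iff (n : ℕ) (M N : ModuleCat.{0} R) :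
    Subsingleton (ext R n M N) ↔ Subsingleton (Abelian.Ext.{0} M N n) := by
  let P := projectiveResolution M
  have e := (P.isoExt (R := R) n N)
  have h1 : Subsingleton (ext R n M N) ↔ ((P.complex.linearYonedaObj R N).ExactAt n) := by
    rw [HomologicalComplex.exactAt_iff_isZero_homology, ← ModuleCat.isZero_iff_subsingleton]
    exact e.isZero_iff
  rw [h1]
  cases n with
  | zero =>
    rw [HomologicalComplex.exactAt_iff' _ 0 0 1 (by simp) (by simp),
      ShortComplex.moduleCat_exact_iff]
    rw [Abelian.Ext.homEquiv₀.subsingleton_congr]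
    have hd : ∀ (q : P.complex.X 0 ⟶ N), P.complex.d 0 0 ≫ q = 0 := by
      intro q
      rw [P.complex.shape 0 0 (by simp), Limits.zero_comp]
    constructor
    · intro h
      refine subsingleton_of_forall_eq 0 fun a => ?_
      have h2 : P.complex.d 1 0 ≫ (prπ P ≫ a) = 0 := by
        rw [← Category.assoc, d_prπ, Limits.zero_comp]
      obtain ⟨(q : P.complex.X 0 ⟶ N), hq⟩ := h (prπ P ≫ a) h2
      have h3 : prπ P ≫ a = 0 := hq.symm.trans (hd q)
      ext x
      obtain ⟨y, rfl⟩ := surj_prπ P x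
      exact congrArg (fun t => t y) (ModuleCat.hom_ext_iff.1 h3 ▸ rfl : (prπ P ≫ a).hom = 0)
    · intro h (f : P.complex.X 0 ⟶ N) (hf : P.complex.d 1 0 ≫ f = 0)
      refine ⟨0, ?_⟩
      rw [map_zero]
      symm
      have hc := P.isColimitCokernelCofork
      have h4 := hc.fac (Limits.CokernelCofork.ofπ f hf) Limits.WalkingParallelPair.one
      let a : M ⟶ N := hc.desc (Limits.CokernelCofork.ofπ f hf)
      have ha : a = 0 := Subsingleton.elim _ _
      have h5 : prπ P ≫ a = f := h4
      rw [← h5, ha, Limits.comp_zero]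
      rfl
  | succ n =>
    rw [HomologicalComplex.exactAt_iff' _ n (n+1) (n+2) (by simp) (by simp),
      ShortComplex.moduleCat_exact_iff]
    constructor
    · intro h
      refine subsingleton_of_forall_eq 0 fun x => ?_
      obtain ⟨f, hf, rfl⟩ := P.extMk_surjective x (n+2) rfl
      rw [P.extMk_eq_zero_iff f _ rfl hf n rfl]
      obtain ⟨g, hg⟩ := h f hf
      exact ⟨g, hg⟩
    · intro h f hf
      have := (P.extMk_eq_zero_iff f _ rfl hf n rfl).1 (Subsingleton.elim _ _)
      obtain ⟨g, hg⟩ := this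
      exact ⟨g, hg⟩

lemma splice_exact {X' F X : ModuleCat.{0} R} (f : X' ⟶ F) (g : F ⟶ X) (w : f ≫ g = 0)
    (hS : (ShortComplex.mk f g w).ShortExact) (P : ProjectiveResolution X') :
    (ShortComplex.mk (prπ P ≫ f) g (by rw [Category.assoc, w, Limits.comp_zero])).Exact := by
  have he := (ShortComplex.ShortExact.moduleCat_exact_iff_function_exact _).1 hS.exact
  rw [ShortComplex.moduleCat_exact_iff]
  intro x hx
  obtain ⟨y, rfl⟩ := (he x).1 hx
  obtain ⟨z, rfl⟩ := surj_prπ P y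
  exact ⟨z, rfl⟩

lemma splice_exact' {X' F X : ModuleCat.{0} R} (f : X' ⟶ F) (g : F ⟶ X) (w : f ≫ g = 0)
    (hS : (ShortComplex.mk f g w).ShortExact) (P : ProjectiveResolution X') :
    (ShortComplex.mk (P.complex.d 1 0) (prπ P ≫ f)
      (by rw [← Category.assoc, d_prπ, Limits.zero_comp])).Exact := by
  rw [ShortComplex.moduleCat_exact_iff]
  intro x hx
  have h1 : prπ P x = 0 := hS.moduleCat_injective_f (hx.trans (map_zero _).symm)
  exact (exact_prπ P x).1 h1

def splice {X' F X : ModuleCat.{0} R} (f : X' ⟶ F) (g : F ⟶ X) (w : f ≫ g = 0)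
    (hS : (ShortComplex.mk f g w).ShortExact) [Projective F] (P : ProjectiveResolution X') :
    ProjectiveResolution X where
  complex := P.complex.augment (prπ P ≫ f)
    (by rw [← Category.assoc, d_prπ, Limits.zero_comp])
  projective := by
    rintro (_ | n)
    · dsimp; infer_instance
    · dsimp; infer_instance
  π := (ChainComplex.toSingle₀Equiv _ _).symm ⟨g, by
    dsimp
    rw [Category.assoc, w, Limits.comp_zero]
    rfl⟩
  quasiIso := ⟨fun n => by
    rcases n with _ | n
    · rw [ChainComplex.quasiIsoAt₀_iff, ShortComplex.quasiIso_iff_of_zeros']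
      · dsimp
        exact ⟨splice_exact f g w hS P, hS.epi_g⟩
      all_goals rfl
    · rw [quasiIsoAt_iff_exactAt']
      · cases n with
        | zero =>
          rw [HomologicalComplex.exactAt_iff' _ 2 1 0 (by simp) (by simp)]
          exact splice_exact' f g w hS P
        | succ n =>
          rw [HomologicalComplex.exactAt_iff' _ (n+3) (n+2) (n+1) (by simp) (by simp)]
          exact P.exact_succ n
      · apply ChainComplex.exactAt_succ_single_obj⟩

open scoped MonoidalCategory

lemma tor_iff {X : ModuleCat.{0} R} (N : ModuleCat.{0} R) (P : ProjectiveResolution X) (n : ℕ) :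
    Subsingleton (tor R (n+1) N X) ↔
      Function.Exact ((P.complex.d (n+2) (n+1)).hom.lTensor N) ((P.complex.d (n+1) n).hom.lTensor N) := by
  have e := P.isoLeftDerivedObj ((MonoidalCategory.tensoringLeft (ModuleCat R)).obj N) (n+1)
  rw [← ModuleCat.isZero_iff_subsingleton]
  refine (e.isZero_iff).trans ?_
  refine (HomologicalComplex.exactAt_iff_isZero_homology _ _).symm.trans ?_
  rw [HomologicalComplex.exactAt_iff' _ (n+2) (n+1) n (by simp) (by simp)]
  rw [ShortComplex.ShortExact.moduleCat_exact_iff_function_exact]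
  rfl

/-- dimension shifting for vanishing of Tor in degree two. -/
lemma tor_two {X' F X : ModuleCat.{0} R} (N : ModuleCat.{0} R)
    (f : X' ⟶ F) (g : F ⟶ X) (w : f ≫ g = 0)
    (hS : (ShortComplex.mk f g w).ShortExact) [Projective F] :
    Subsingleton (tor R 2 N X) ↔ Subsingleton (tor R 1 N X') := by
  let P := projectiveResolution X'
  rw [tor_iff N P 0, tor_iff N (splice f g w hS P) 1]
  rfl

lemma tor_one {X' F X : ModuleCat.{0} R} (N : ModuleCat.{0} R)
    (f : X' ⟶ F) (g : F ⟶ X) (w : f ≫ g = 0)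
    (hS : (ShortComplex.mk f g w).ShortExact) [Projective F] :
    Subsingleton (tor R 1 N X) ↔ Function.Injective (f.hom.lTensor N) := by
  let P := projectiveResolution X'
  rw [tor_iff N (splice f g w hS P) 0]
  change Function.Exact ((P.complex.d 1 0).hom.lTensor N) ((f.hom ∘ₗ (prπ P).hom).lTensor N) ↔ _
  have hex : Function.Exact ((P.complex.d 1 0).hom.lTensor N) ((prπ P).hom.lTensor N) :=
    lTensor_exact N (exact_prπ P) (surj_prπ P)
  have hsu : Function.Surjective ((prπ P).hom.lTensor N) :=
    LinearMap.lTensor_surjective N (surj_prπ P)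
  rw [LinearMap.lTensor_comp]
  constructor
  · intro h
    rw [injective_iff_map_eq_zero]
    intro x hx
    obtain ⟨y, rfl⟩ := hsu x
    exact (hex y).2 ((h y).1 hx)
  · intro h y
    rw [← hex y]
    constructor
    · intro h2
      exact h (h2.trans (map_zero _).symm)
    · intro h2
      simp [h2]

end Part1

section Part2

variable {R}

lemma pd_le_iff (M : ModuleCat.{0} R) (p : ℕ) :
    projDim R M ≤ p ↔ HasProjectiveDimensionLT M (p + 1) := by
  have hmem : projDim R M ∈
      {n : ℕ∞ | ∀ (i : ℕ) (X : ModuleCat R), n < i → Subsingleton (ext R i M X)} :=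
    csInf_mem ⟨⊤, by simp⟩
  constructor
  · intro h
    refine HasProjectiveDimensionLT.mk fun i hi Y e => ?_
    have := (ext_sub_iff R i M Y).1 (hmem i Y (lt_of_le_of_lt h (by exact_mod_cast hi)))
    exact Subsingleton.elim _ _
  · intro h
    refine sInf_le ?_
    intro i X hi
    rw [ext_sub_iff]
    exact HasProjectiveDimensionLT.subsingleton M (p+1) i (by exact_mod_cast hi) X

lemma pd_lt_top (M : ModuleCat.{0} R) (h : projDim R M < ⊤) :
    ∃ p : ℕ, HasProjectiveDimensionLT M (p + 1) := by
  obtain ⟨p, hp⟩ := ENat.ne_top_iff_exists.1 h.ne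
  exact ⟨p, (pd_le_iff M p).1 hp.ge⟩

/-- covariant functoriality of `Ext`, linear in the morphism. -/
def extMap (A : ModuleCat.{0} R) (n : ℕ) {B C : ModuleCat.{0} R} :
    (B ⟶ C) →ₗ[R] Abelian.Ext.{0} A B n →ₗ[R] Abelian.Ext.{0} A C n :=
  (Abelian.Ext.bilinearCompOfLinear R A B C n 0 n (add_zero n)).flip ∘ₗ
    (Abelian.Ext.linearEquiv₀ (R := R)).symm.toLinearMap

lemma extMap_apply (A : ModuleCat.{0} R) (n : ℕ) {B C : ModuleCat.{0} R} (f : B ⟶ C)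
    (x : Abelian.Ext.{0} A B n) :
    extMap A n f x = x.comp (Abelian.Ext.mk₀ f) (add_zero n) := rfl

lemma extMap_id (A : ModuleCat.{0} R) (n : ℕ) {B : ModuleCat.{0} R}
    (x : Abelian.Ext.{0} A B n) : extMap A n (𝟙 B) x = x := by
  rw [extMap_apply, Abelian.Ext.comp_mk₀_id]

lemma extMap_comp (A : ModuleCat.{0} R) (n : ℕ) {B C D : ModuleCat.{0} R} (f : B ⟶ C) (g : C ⟶ D)
    (x : Abelian.Ext.{0} A B n) : extMap A n (f ≫ g) x = extMap A n g (extMap A n f x) := by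
  simp [extMap_apply]

lemma extMap_surj (A : ModuleCat.{0} R) (p : ℕ) [HasProjectiveDimensionLT A (p + 1)]
    {B C : Type} [AddCommGroup B] [Module R B] [AddCommGroup C] [Module R C]
    (f : B →ₗ[R] C) (hf : Function.Surjective f) :
    Function.Surjective (extMap A p (ModuleCat.ofHom f)) := by
  intro x
  exact Abelian.Ext.covariant_sequence_exact₃ A (LinearMap.shortExact_shortComplexKer hf) x rfl
    (Abelian.Ext.eq_zero_of_hasProjectiveDimensionLT _ (p+1) le_rfl)

lemma ext_sub_of_sum (A : ModuleCat.{0} R) (n : ℕ) {B C : ModuleCat.{0} R} {ι : Type} [Fintype ι]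
    (p : ι → (C ⟶ B)) (i : ι → (B ⟶ C)) (h : 𝟙 C = ∑ j, p j ≫ i j)
    (hs : Subsingleton (Abelian.Ext.{0} A B n)) : Subsingleton (Abelian.Ext.{0} A C n) := by
  refine subsingleton_of_forall_eq 0 fun x => ?_
  rw [← extMap_id A n x, h, map_sum, LinearMap.sum_apply]
  refine Finset.sum_eq_zero fun j _ => ?_
  rw [extMap_comp, Subsingleton.elim (extMap A n (p j) x) 0, map_zero]

lemma pi_id_sum (r : ℕ) : 𝟙 (ModuleCat.of R (Fin r → R)) =
    ∑ j, ModuleCat.ofHom (LinearMap.proj (R := R) (φ := fun _ : Fin r => R) j) ≫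
      ModuleCat.ofHom (LinearMap.single R (fun _ : Fin r => R) j) := by
  ext1
  rw [ModuleCat.hom_sum]
  refine LinearMap.ext fun x => ?_
  rw [LinearMap.sum_apply]
  exact (Finset.univ_sum_single x).symm

variable [IsLocalRing R]

lemma exists_surj_residue (N : Type) [AddCommGroup N] [Module R N] [Module.Finite R N]
    [Nontrivial N] : ∃ f : N →ₗ[R] IsLocalRing.ResidueField R, Function.Surjective f := by
  let k := IsLocalRing.ResidueField R
  have h1 : Nontrivial (TensorProduct R k N) := by
    rw [← not_subsingleton_iff_nontrivial, IsLocalRing.subsingleton_tensorProduct]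
    exact not_subsingleton N
  obtain ⟨v, hv⟩ := exists_ne (0 : TensorProduct R k N)
  obtain ⟨φ, hφ⟩ : ∃ φ : Module.Dual k (TensorProduct R k N), φ v ≠ 0 := by
    by_contra! h
    exact hv ((Module.forall_dual_apply_eq_zero_iff k v).1 h)
  let f : N →ₗ[R] k := (φ.restrictScalars R) ∘ₗ (TensorProduct.mk R k N 1)
  have hn : ∃ n, f n ≠ 0 := by
    by_contra! h
    apply hφ
    have : φ = 0 := by
      apply TensorProduct.AlgebraTensorModule.curry_injective
      ext n
      exact h n
    rw [this, LinearMap.zero_apply]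
  obtain ⟨n, hn⟩ := hn
  refine ⟨f, fun y => ?_⟩
  obtain ⟨r, hr⟩ := IsLocalRing.residue_surjective (y / f n)
  refine ⟨r • n, ?_⟩
  rw [map_smul, Algebra.smul_def]
  change IsLocalRing.residue R r * f n = y
  rw [hr, div_mul_cancel₀ _ hn]

lemma smul_ext_residue (n : ℕ) (B : ModuleCat.{0} R) (r : R) (hr : r ∈ IsLocalRing.maximalIdeal R)
    (x : Abelian.Ext.{0} (ModuleCat.of R (IsLocalRing.ResidueField R)) B n) : r • x = 0 := by
  have h0 : r • 𝟙 (ModuleCat.of R (IsLocalRing.ResidueField R)) = 0 := by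
    ext (y : IsLocalRing.ResidueField R)
    change r • y = 0
    rw [Algebra.smul_def]
    have : IsLocalRing.residue R r = 0 := (IsLocalRing.residue_eq_zero_iff r).2 hr
    change IsLocalRing.residue R r * y = 0
    rw [this, zero_mul]
  have := Abelian.Ext.mk₀_id_comp x
  rw [← this, ← Abelian.Ext.smul_comp, ← Abelian.Ext.mk₀_smul, h0, Abelian.Ext.mk₀_zero,
    Abelian.Ext.zero_comp]

variable [IsNoetherianRing R]

/-- If `pd M ≤ p` and `Ext^p(M,N) = 0` with `N ≠ 0` finite, then `pd M < p`. -/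
lemma pd_drop (M N : ModuleCat.{0} R) [Module.Finite R M] [Module.Finite R N] (hN : Nontrivial N)
    (p : ℕ) (hpd : HasProjectiveDimensionLT M (p + 1)) (h : Subsingleton (Abelian.Ext.{0} M N p)) :
    HasProjectiveDimensionLT M p := by
  have hk : Subsingleton (Abelian.Ext.{0} M (ModuleCat.of R (IsLocalRing.ResidueField R)) p) := by
    obtain ⟨f, hf⟩ := exists_surj_residue (R := R) N
    exact (extMap_surj M p f hf).subsingleton
  have hR : Subsingleton (Abelian.Ext.{0} M (ModuleCat.of R R) p) := by
    have hfin : Module.Finite R (Abelian.Ext.{0} M (ModuleCat.of R R) p) := inferInstance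
    have key : (⊤ : Submodule R (Abelian.Ext.{0} M (ModuleCat.of R R) p)) ≤
        IsLocalRing.maximalIdeal R • ⊤ := by
      intro x _
      have hsurj : Function.Surjective (Algebra.linearMap R (IsLocalRing.ResidueField R)) :=
        IsLocalRing.residue_surjective
      obtain ⟨y, hy⟩ := Abelian.Ext.covariant_sequence_exact₂ M
        (LinearMap.shortExact_shortComplexKer hsurj) x (Subsingleton.elim _ _)
      have : Module.Finite R (LinearMap.ker (Algebra.linearMap R (IsLocalRing.ResidueField R))) :=
        inferInstance
      obtain ⟨r, g, hg⟩ := Module.Finite.exists_fin' R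
        (LinearMap.ker (Algebra.linearMap R (IsLocalRing.ResidueField R)))
      obtain ⟨z, hz⟩ := extMap_surj M p g hg y
      have hx : x = extMap M p (ModuleCat.ofHom
          (LinearMap.ker (Algebra.linearMap R (IsLocalRing.ResidueField R))).subtype)
          (extMap M p (ModuleCat.ofHom g) z) := by
        rw [hz]; exact hy.symm
      rw [hx, ← extMap_id M p z, pi_id_sum, map_sum, LinearMap.sum_apply, map_sum, map_sum]
      refine Submodule.sum_mem _ fun j _ => ?_
      rw [extMap_comp]
      set e := extMap M p (ModuleCat.ofHom (LinearMap.proj (R := R) (φ := fun _ : Fin r => R) j)) z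
      rw [← extMap_comp, ← extMap_comp]
      let a := g (Pi.single j 1)
      have ha : (ModuleCat.ofHom (LinearMap.single R (fun _ : Fin r => R) j) ≫ ModuleCat.ofHom g) ≫
          ModuleCat.ofHom
          (LinearMap.ker (Algebra.linearMap R (IsLocalRing.ResidueField R))).subtype =
          (a : R) • 𝟙 (ModuleCat.of R R) := by
        ext
        change (g (Pi.single j 1) : R) = (a : R) • 1
        simp [a]
      rw [← Category.assoc, ha, map_smul, LinearMap.smul_apply, extMap_id]
      refine Submodule.smul_mem_smul ?_ trivial
      exact (IsLocalRing.residue_eq_zero_iff _).1 a.2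
    have hbot : (⊤ : Submodule R (Abelian.Ext.{0} M (ModuleCat.of R R) p)) = ⊥ :=
      Submodule.eq_bot_of_le_smul_of_le_jacobson_bot _ _ Module.Finite.fg_top key
        (IsLocalRing.maximalIdeal_le_jacobson _)
    exact (Submodule.subsingleton_iff R).1 (subsingleton_of_bot_eq_top hbot.symm)
  refine ModuleCat.hasProjectiveDimensionLT_of_forall_finite M p fun L hL => ?_
  obtain ⟨r, g, hg⟩ := Module.Finite.exists_fin' R L
  have := ext_sub_of_sum M p _ _ (pi_id_sum (R := R) r) hR
  exact (extMap_surj M p g hg).subsingleton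

end Part2

section Part3

variable {R}

open TensorProduct

lemma ext_free (A N : ModuleCat.{0} R) (n b : ℕ)
    (hs : Subsingleton (Abelian.Ext.{0} A N n)) :
    Subsingleton (Abelian.Ext.{0} A (ModuleCat.of R (N ⊗[R] (Fin b → R))) n) := by
  refine ext_sub_of_sum A n (B := N)
    (fun j => ModuleCat.ofHom ((TensorProduct.rid R N).toLinearMap ∘ₗ
      (LinearMap.proj (R := R) (φ := fun _ : Fin b => R) j).lTensor N))
    (fun j => ModuleCat.ofHom ((TensorProduct.mk R N (Fin b → R)).flip (Pi.single j 1))) ?_ hs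
  ext1
  rw [ModuleCat.hom_sum]
  apply TensorProduct.ext'
  intro x y
  rw [LinearMap.sum_apply]
  simp only [ModuleCat.hom_id, LinearMap.id_coe, id_eq, ModuleCat.hom_comp, ModuleCat.hom_ofHom,
    LinearMap.comp_apply, LinearMap.lTensor_tmul, LinearMap.proj_apply, LinearEquiv.coe_coe,
    TensorProduct.rid_tmul, LinearMap.flip_apply, TensorProduct.mk_apply, TensorProduct.smul_tmul]
  rw [← TensorProduct.tmul_sum]
  congr 1
  conv_lhs => rw [← Finset.univ_sum_single y]
  refine Finset.sum_congr rfl fun j _ => ?_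
  rw [← Pi.single_smul, smul_eq_mul, mul_one]

lemma ext_shift {A : ModuleCat.{0} R} {X Y Z : Type} [AddCommGroup X] [Module R X]
    [AddCommGroup Y] [Module R Y] [AddCommGroup Z] [Module R Z]
    (f : X →ₗ[R] Y) (g : Y →ₗ[R] Z) (hf : Function.Injective f) (hfg : Function.Exact f g)
    (hg : Function.Surjective g) (s : ℕ) (x : Abelian.Ext.{0} A (ModuleCat.of R X) s)
    (hx : x ≠ 0) (hx0 : extMap A s (ModuleCat.ofHom f) x = 0) :
    ∃ s', s' + 1 = s ∧ ¬ Subsingleton (Abelian.Ext.{0} A (ModuleCat.of R Z) s') := by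
  have hm : Mono (ModuleCat.ofHom f) := (ModuleCat.mono_iff_injective _).2 hf
  rcases s with _ | s
  · exfalso
    apply hx
    apply Abelian.Ext.postcomp_mk₀_injective_of_mono A (ModuleCat.ofHom f)
    rw [map_zero]
    exact hx0
  · refine ⟨s, rfl, fun hs => hx ?_⟩
    have hS : (ShortComplex.mk (ModuleCat.ofHom f) (ModuleCat.ofHom g)
        (by ext y; exact hfg.apply_apply_eq_zero y)).ShortExact :=
      ModuleCat.shortComplex_shortExact _ hfg hf hg
    obtain ⟨z, hz⟩ := Abelian.Ext.covariant_sequence_exact₁ A hS x hx0 rfl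
    rw [← hz, Subsingleton.elim z 0, Abelian.Ext.zero_comp]

variable [IsLocalRing R] [IsNoetherianRing R]

/-- if the inclusion of a free module does not split there is a minimal generator in `m F`. -/
lemma exists_min_gen {Y : Type} [AddCommGroup Y] [Module R Y] [Module.Finite R Y]
    [Module.Free R Y] {b : ℕ} (f : Y →ₗ[R] (Fin b → R))
    (h : ¬ ∃ l, l ∘ₗ f = LinearMap.id) :
    ∃ (x : Y) (l : Y →ₗ[R] R), l x = 1 ∧ ∀ j, f x j ∈ IsLocalRing.maximalIdeal R := by
  rw [IsLocalRing.split_injective_iff_lTensor_residueField_injective] at h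
  by_contra! hc
  apply h
  rw [injective_iff_map_eq_zero]
  intro z hz
  let k := IsLocalRing.ResidueField R
  obtain ⟨y, rfl⟩ : ∃ y : Y, (1 : k) ⊗ₜ[R] y = z := by
    clear hz
    induction z using TensorProduct.induction_on with
    | zero => exact ⟨0, by simp⟩
    | tmul a y =>
      obtain ⟨r, rfl⟩ := IsLocalRing.residue_surjective a
      refine ⟨r • y, ?_⟩
      rw [← TensorProduct.smul_tmul, Algebra.smul_def, mul_one]; rfl
    | add a b ha hb =>
      obtain ⟨y, rfl⟩ := ha
      obtain ⟨y', rfl⟩ := hb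
      exact ⟨y + y', TensorProduct.tmul_add _ _ _⟩
  have hy : ∀ j, f y j ∈ IsLocalRing.maximalIdeal R := by
    intro j
    have := congrArg ((TensorProduct.rid R k).toLinearMap ∘ₗ
      (LinearMap.proj (R := R) (φ := fun _ : Fin b => R) j).lTensor k) hz
    simp only [LinearMap.comp_apply, LinearMap.lTensor_tmul, LinearMap.proj_apply,
      LinearEquiv.coe_coe, TensorProduct.rid_tmul, map_zero] at this
    rw [Algebra.smul_def, mul_one] at this
    exact (IsLocalRing.residue_eq_zero_iff _).1 this
  have hl : ∀ l : Y →ₗ[R] R, l y ∈ IsLocalRing.maximalIdeal R := by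
    intro l
    by_contra hu
    rw [IsLocalRing.mem_maximalIdeal, mem_nonunits_iff, not_not] at hu
    obtain ⟨u, hu⟩ := hu
    obtain ⟨j, hj⟩ := hc y ((↑u⁻¹ : R) • l) (by simp [← hu])
    exact hj (hy j)
  let B := Module.Free.chooseBasis R Y
  have : Fintype (Module.Free.ChooseBasisIndex R Y) := inferInstance
  rw [← B.sum_repr y, TensorProduct.tmul_sum]
  refine Finset.sum_eq_zero fun i _ => ?_
  rw [← TensorProduct.smul_tmul, Algebra.smul_def, mul_one]
  have h0 : algebraMap R k (B.repr y i) = 0 :=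
    (IsLocalRing.residue_eq_zero_iff _).2 (hl (B.coord i))
  rw [h0, TensorProduct.zero_tmul]

lemma ext_tmul_zero (N : ModuleCat.{0} R) (t b : ℕ) (v : Fin b → R)
    (hv : ∀ j, v j ∈ IsLocalRing.maximalIdeal R)
    (x : Abelian.Ext.{0} (ModuleCat.of R (IsLocalRing.ResidueField R)) N t) :
    extMap _ t (ModuleCat.ofHom ((TensorProduct.mk R N (Fin b → R)).flip v)) x = 0 := by
  have : ModuleCat.ofHom ((TensorProduct.mk R N (Fin b → R)).flip v) = ∑ j, v j •
      (ModuleCat.ofHom ((TensorProduct.mk R N (Fin b → R)).flip (Pi.single j 1)) :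
        N ⟶ ModuleCat.of R (N ⊗[R] (Fin b → R))) := by
    ext1
    rw [ModuleCat.hom_sum]
    ext1 y
    rw [LinearMap.sum_apply]
    simp only [ModuleCat.hom_ofHom, ModuleCat.hom_smul, LinearMap.smul_apply,
      LinearMap.flip_apply, TensorProduct.mk_apply]
    conv_lhs => rw [← Finset.univ_sum_single v]
    rw [TensorProduct.tmul_sum]
    refine Finset.sum_congr rfl fun j _ => ?_
    rw [← TensorProduct.tmul_smul, ← Pi.single_smul, smul_eq_mul, mul_one]
  rw [this, map_sum, LinearMap.sum_apply]
  refine Finset.sum_eq_zero fun j _ => ?_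
  rw [map_smul, LinearMap.smul_apply]
  exact smul_ext_residue t _ _ (hv j) _

lemma depth_aux (N : ModuleCat.{0} R) [Module.Finite R N] (hrt : RigidTest R N) (t : ℕ)
    (ht : ¬ Subsingleton (Abelian.Ext.{0} (ModuleCat.of R (IsLocalRing.ResidueField R)) N t))
    (hlt : ∀ i < t,
      Subsingleton (Abelian.Ext.{0} (ModuleCat.of R (IsLocalRing.ResidueField R)) N i)) (p : ℕ) :
    ∀ (Y : Type) [AddCommGroup Y] [Module R Y] [Module.Finite R Y],
      HasProjectiveDimensionLT (ModuleCat.of R Y) (p + 2) →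
      ¬ HasProjectiveDimensionLT (ModuleCat.of R Y) (p + 1) →
      Subsingleton (tor R 1 N (ModuleCat.of R Y)) →
      ∃ s, s + (p + 1) = t ∧ ¬ Subsingleton (Abelian.Ext.{0}
        (ModuleCat.of R (IsLocalRing.ResidueField R)) (ModuleCat.of R (N ⊗[R] Y)) s) := by
  induction p with
  | zero =>
    intro Y _ _ _ h1 h2 h3
    obtain ⟨b, g, hg⟩ := Module.Finite.exists_fin' R Y
    have hS := LinearMap.shortExact_shortComplexKer hg
    have hF : Projective g.shortComplexKer.X₂ :=
      (IsProjective.iff_projective (R := R) (P := Fin b → R)).1 inferInstance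
    have hinj := (tor_one N _ _ _ hS).1 h3
    have hY' : HasProjectiveDimensionLT g.shortComplexKer.X₁ 1 :=
      (hS.hasProjectiveDimensionLT_X₃_iff 0 hF).1 h1
    have hproj : Module.Projective R (LinearMap.ker g) :=
      (IsProjective.iff_projective _).2 (projective_iff_hasProjectiveDimensionLT_one.2 hY')
    have hfree : Module.Free R (LinearMap.ker g) := Module.free_of_flat_of_isLocalRing
    have hns : ¬ ∃ l, l ∘ₗ (LinearMap.ker g).subtype = LinearMap.id := by
      rintro ⟨l, hl⟩
      apply h2
      have htf := (Function.Exact.split_tfae (LinearMap.exact_subtype_ker_map g)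
        Subtype.val_injective hg).out 0 1
      obtain ⟨l', hl'⟩ := htf.2 ⟨l, hl⟩
      have : Module.Projective R Y := Module.Projective.of_split l' g hl'
      exact projective_iff_hasProjectiveDimensionLT_one.1
        ((IsProjective.iff_projective (R := R) Y).1 this)
    obtain ⟨x, l, hl, hx⟩ := exists_min_gen _ hns
    rw [not_subsingleton_iff_nontrivial] at ht
    obtain ⟨e, he⟩ := exists_ne (0 : Abelian.Ext.{0} (ModuleCat.of R (IsLocalRing.ResidueField R)) N t)
    let i : N ⟶ ModuleCat.of R (N ⊗[R] LinearMap.ker g) :=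
      ModuleCat.ofHom ((TensorProduct.mk R N (LinearMap.ker g)).flip x)
    let q : ModuleCat.of R (N ⊗[R] LinearMap.ker g) ⟶ N :=
      ModuleCat.ofHom ((TensorProduct.rid R N).toLinearMap ∘ₗ l.lTensor N)
    have hiq : i ≫ q = 𝟙 N := by
      ext y
      simp [i, q, hl]
    refine ext_shift _ _ hinj (lTensor_exact N (LinearMap.exact_subtype_ker_map g) hg)
      (LinearMap.lTensor_surjective N hg) t (extMap _ t i e) ?_ ?_
    · intro h0
      apply he
      rw [← extMap_id _ _ e, ← hiq, extMap_comp, h0, map_zero]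
    · rw [← extMap_comp]
      exact ext_tmul_zero N t b _ hx e
  | succ p ih =>
    intro Y _ _ _ h1 h2 h3
    obtain ⟨b, g, hg⟩ := Module.Finite.exists_fin' R Y
    have hS := LinearMap.shortExact_shortComplexKer hg
    have hF : Projective g.shortComplexKer.X₂ :=
      (IsProjective.iff_projective (R := R) (P := Fin b → R)).1 inferInstance
    have hinj := (tor_one N _ _ _ hS).1 h3
    have h4 := (tor_two N _ _ _ hS).1 (hrt _ ‹_› 1 le_rfl h3).1
    obtain ⟨s, hs, hne⟩ := ih (LinearMap.ker g)
      ((hS.hasProjectiveDimensionLT_X₃_iff (p+1) hF).1 h1)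
      (fun h => h2 ((hS.hasProjectiveDimensionLT_X₃_iff p hF).2 h)) h4
    rw [not_subsingleton_iff_nontrivial] at hne
    obtain ⟨e, he⟩ := exists_ne (0 : Abelian.Ext.{0}
        (ModuleCat.of R (IsLocalRing.ResidueField R)) (ModuleCat.of R (N ⊗[R] LinearMap.ker g)) s)
    have := ext_free _ N s b (hlt s (by omega))
    obtain ⟨s', hs', h5⟩ := ext_shift _ _ hinj
      (lTensor_exact N (LinearMap.exact_subtype_ker_map g) hg)
      (LinearMap.lTensor_surjective N hg) s e he
      ((ext_free _ N s b (hlt s (by omega))).elim _ _)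
    exact ⟨s', by omega, h5⟩

lemma pd_le_depth (N : ModuleCat.{0} R) [Module.Finite R N] (hrt : RigidTest R N) (n : ℕ)
    (hn : depth R N ≤ (n : ℕ∞)) (X : Type) [AddCommGroup X] [Module R X] [Module.Finite R X]
    (hX : Subsingleton (tor R 1 N (ModuleCat.of R X))) :
    HasProjectiveDimensionLT (ModuleCat.of R X) (n + 1) := by
  classical
  have hex : ∃ i : ℕ, ¬ Subsingleton (Abelian.Ext.{0}
      (ModuleCat.of R (IsLocalRing.ResidueField R)) N i) := by
    by_contra! hc
    have : depth R N = ⊤ := by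
      unfold depth
      rw [sInf_eq_top]
      rintro a ⟨i, rfl, hi⟩
      exact absurd ((ext_sub_iff R i _ _).2 (hc i)) hi
    rw [this] at hn
    simp at hn
  have htn : Nat.find hex ≤ n := by
    have : ((Nat.find hex : ℕ) : ℕ∞) ≤ depth R N := by
      refine le_sInf ?_
      rintro a ⟨i, rfl, hi⟩
      rw [ext_sub_iff] at hi
      exact_mod_cast Nat.find_min' hex hi
    exact_mod_cast this.trans hn
  obtain ⟨p, hp⟩ := pd_lt_top _ (hrt _ ‹_› 1 le_rfl hX).2
  by_contra hcon
  have hex2 : ∃ q, HasProjectiveDimensionLT (ModuleCat.of R X) q := ⟨_, hp⟩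
  set q := Nat.find hex2 with hq
  have hq1 : HasProjectiveDimensionLT (ModuleCat.of R X) q := Nat.find_spec hex2
  have hq2 : n + 1 < q := by
    by_contra! hle
    exact hcon (hasProjectiveDimensionLT_of_ge _ q (n+1) hle)
  obtain ⟨r, hr⟩ : ∃ r, q = r + 2 := ⟨q - 2, by omega⟩
  obtain ⟨s, hs, -⟩ := depth_aux N hrt (Nat.find hex) (Nat.find_spec hex)
    (fun i hi => not_not.1 (Nat.find_min hex hi)) r X (hr ▸ hq1)
    (Nat.find_min hex2 (by omega)) hX
  omega

end Part3

section Part4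

variable {R}

open TensorProduct

/-- `Syz M n W`: `W` is an `n`-th syzygy of `M` (finite free resolutions). -/
inductive Syz (M : ModuleCat.{0} R) : ℕ → ModuleCat.{0} R → Prop
  | zero : Syz M 0 M
  | succ (n : ℕ) (V : ModuleCat.{0} R) (b : ℕ) (g : (Fin b → R) →ₗ[R] V)
      (hg : Function.Surjective g) (hV : Syz M n V) :
      Syz M (n + 1) (ModuleCat.of R (LinearMap.ker g))

lemma proj_pi (b : ℕ) : Projective (ModuleCat.of R (Fin b → R)) :=
  (IsProjective.iff_projective (R := R) (P := Fin b → R)).1 inferInstance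

lemma syz_exists [IsNoetherianRing R] (M : ModuleCat.{0} R) [Module.Finite R M] (n : ℕ) :
    ∃ W : ModuleCat.{0} R, Module.Finite R W ∧ Syz M n W := by
  induction n with
  | zero => exact ⟨M, ‹_›, Syz.zero⟩
  | succ n ih =>
    obtain ⟨V, hV, hS⟩ := ih
    obtain ⟨b, g, hg⟩ := Module.Finite.exists_fin' R V
    exact ⟨_, (inferInstance : Module.Finite R (LinearMap.ker g)), Syz.succ n V b g hg hS⟩

lemma syz_pd {M W : ModuleCat.{0} R} {n : ℕ} (h : Syz M n W) :
    ∀ k, HasProjectiveDimensionLT W (k + 1) → HasProjectiveDimensionLT M (n + k + 1) := by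
  induction h with
  | zero => intro k hk; rwa [zero_add]
  | succ n V b g hg hV ih =>
    intro k hk
    have := ih (k + 1) (((LinearMap.shortExact_shortComplexKer hg).hasProjectiveDimensionLT_X₃_iff
      k (proj_pi b)).2 hk)
    rwa [show n + 1 + k + 1 = n + (k + 1) + 1 by omega]

lemma syz_ext {M W : ModuleCat.{0} R} {n : ℕ} (h : Syz M n W) (N : ModuleCat.{0} R) :
    ∀ k, Subsingleton (Abelian.Ext.{0} M N (n + k + 1)) →
      Subsingleton (Abelian.Ext.{0} W N (k + 1)) := by
  induction h with
  | zero => intro k hk; rwa [zero_add] at hk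
  | succ n V b g hg hV ih =>
    intro k hk
    have hV2 := ih (k + 1) (by rwa [show n + 1 + k + 1 = n + (k + 1) + 1 by omega] at hk)
    have hP := proj_pi (R := R) b
    refine subsingleton_of_forall_eq 0 fun x => ?_
    obtain ⟨y, hy⟩ := Abelian.Ext.contravariant_sequence_exact₁
      (LinearMap.shortExact_shortComplexKer hg) N x (n₁ := k + 1 + 1) (by omega) (hV2.elim _ _)
    rw [← hy, show y = 0 from Abelian.Ext.eq_zero_of_projective (P := ModuleCat.of R (Fin b → R)) y,
      Abelian.Ext.comp_zero]

lemma syz_factor {M W : ModuleCat.{0} R} {n : ℕ} (h : Syz M n W) (N : ModuleCat.{0} R)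
    (hs : Subsingleton (Abelian.Ext.{0} M N n)) (φ : W →ₗ[R] N) :
    φ ∈ LinearMap.range (dualTensorHom R W N) := by
  cases h with
  | zero =>
    have : φ = 0 := by
      have h0 := hs.elim (Abelian.Ext.mk₀ (ModuleCat.ofHom φ)) (Abelian.Ext.mk₀ 0)
      have := (Abelian.Ext.mk₀_bijective _ _).1 h0
      exact congrArg ModuleCat.Hom.hom this
    rw [this]
    exact zero_mem _
  | succ n V b g hg hV =>
    have hV2 := syz_ext hV N 0 hs
    obtain ⟨y, hy⟩ := Abelian.Ext.contravariant_sequence_exact₁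
      (LinearMap.shortExact_shortComplexKer hg) N (Abelian.Ext.mk₀ (ModuleCat.ofHom φ))
      (n₁ := 1) rfl (hV2.elim _ _)
    obtain ⟨β, rfl⟩ := (Abelian.Ext.mk₀_bijective _ _).2 y
    rw [Abelian.Ext.mk₀_comp_mk₀] at hy
    have hφ := congrArg ModuleCat.Hom.hom ((Abelian.Ext.mk₀_bijective _ _).1 hy)
    let β' : (Fin b → R) →ₗ[R] N := β.hom
    have hφ' : φ = β' ∘ₗ (LinearMap.ker g).subtype := hφ.symm
    obtain ⟨w, hw⟩ := (dualTensorHom_bijective_of_finite_projective_right (R := R)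
      (M := LinearMap.ker g) (N := Fin b → R)).2 (LinearMap.ker g).subtype
    refine ⟨β'.lTensor _ w, ?_⟩
    rw [hφ', ← hw]
    exact LinearMap.congr_fun (dualTensorHom_comp_lTensor (R := R) (M := LinearMap.ker g) β') w

lemma free_cover (X : Type) [AddCommGroup X] [Module R X] :
    ∃ (K G : Type) (_ : AddCommGroup K) (_ : Module R K) (_ : AddCommGroup G) (_ : Module R G)
      (_ : Module.Projective R G) (u : K →ₗ[R] G) (q : G →ₗ[R] X),
      Function.Injective u ∧ Function.Exact u q ∧ Function.Surjective q :=
  ⟨LinearMap.ker (Finsupp.linearCombination R (id : X → X)), X →₀ R, inferInstance, inferInstance,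
    inferInstance, inferInstance, inferInstance, Submodule.subtype _,
    Finsupp.linearCombination R (id : X → X), Subtype.val_injective,
    LinearMap.exact_subtype_ker_map _, Finsupp.linearCombination_id_surjective R X⟩

lemma syz_tor {M V : ModuleCat.{0} R} {p : ℕ} (h : Syz M p V) :
    ∀ (X' F X : Type) [AddCommGroup X'] [Module R X'] [AddCommGroup F] [Module R F]
      [AddCommGroup X] [Module R X] [Module.Projective R F] (f : X' →ₗ[R] F) (g : F →ₗ[R] X),
      Function.Injective f → Function.Exact f g → Function.Surjective g →
      HasProjectiveDimensionLT (ModuleCat.of R X) (p + 1) →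
      Function.Injective (f.rTensor V) := by
  induction h with
  | zero =>
    intro X' F X _ _ _ _ _ _ _ f g hf hfg hg hpd
    have hproj : Module.Projective R X :=
      (IsProjective.iff_projective _).2 (projective_iff_hasProjectiveDimensionLT_one.2 hpd)
    obtain ⟨s, hs⟩ := Module.projective_lifting_property g LinearMap.id hg
    have htf := (Function.Exact.split_tfae hfg hf hg).out 0 1
    obtain ⟨l, hl⟩ := htf.1 ⟨s, hs⟩
    have : l.rTensor M ∘ₗ f.rTensor M = .id := by
      rw [← LinearMap.rTensor_comp, hl, LinearMap.rTensor_id]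
    exact Function.HasLeftInverse.injective ⟨_, LinearMap.congr_fun this⟩
  | succ n V b π hπ hV ih =>
    intro X' F X _ _ _ _ _ _ _ f g hf hfg hg hpd
    have hS : (ShortComplex.mk (ModuleCat.ofHom f) (ModuleCat.ofHom g)
        (by ext y; exact hfg.apply_apply_eq_zero y)).ShortExact :=
      ModuleCat.shortComplex_shortExact _ hfg hf hg
    have hX' : HasProjectiveDimensionLT (ModuleCat.of R X') (n + 1) :=
      (hS.hasProjectiveDimensionLT_X₃_iff n
        ((IsProjective.iff_projective (R := R) F).1 inferInstance)).1 hpd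
    obtain ⟨K, G, _, _, _, _, hG, u, q, hu, huq, hq⟩ := free_cover (R := R) X'
    have h1 := ih K G X' u q hu huq hq hX'
    have h2 : Function.Injective ((LinearMap.ker π).subtype.lTensor X') :=
      lTensor_injective_of_exact_of_exact_of_rTensor_injective
        huq hq (LinearMap.exact_subtype_ker_map π) hπ h1
        (Module.Flat.lTensor_preserves_injective_linearMap _ Subtype.val_injective)
    have h3 : Function.Injective (f.rTensor (Fin b → R)) :=
      Module.Flat.rTensor_preserves_injective_linearMap f hf
    have h4 := h3.comp h2
    rw [← LinearMap.coe_comp, LinearMap.rTensor_comp_lTensor, ← LinearMap.lTensor_comp_rTensor,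
      LinearMap.coe_comp] at h4
    exact h4.of_comp

end Part4

section Part5

variable {R}

open TensorProduct

variable {P0 P1 W N E F : Type} [AddCommGroup P0] [Module R P0] [AddCommGroup P1] [Module R P1]
  [AddCommGroup W] [Module R W] [AddCommGroup N] [Module R N] [AddCommGroup E] [Module R E]
  [AddCommGroup F] [Module R F]

lemma factor_surj (π : P0 →ₗ[R] W) (hπ : Function.Surjective π) (d : P1 →ₗ[R] P0)
    (hd : Function.Exact d π) (ψ : P0 →ₗ[R] N) (h : ψ ∘ₗ d = 0) : ∃ φ : W →ₗ[R] N, φ ∘ₗ π = ψ := by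
  have hk : LinearMap.ker π ≤ LinearMap.ker ψ := by
    intro x hx
    obtain ⟨y, rfl⟩ := (hd x).1 hx
    exact LinearMap.congr_fun h y
  refine ⟨(LinearMap.ker π).liftQ ψ hk ∘ₗ (π.quotKerEquivOfSurjective hπ).symm.toLinearMap, ?_⟩
  ext x
  have : (π.quotKerEquivOfSurjective hπ).symm (π x) = Submodule.Quotient.mk x := by
    rw [LinearEquiv.symm_apply_eq]; rfl
  simp [this]

lemma transpose_one [Module.Finite R P0] [Module.Projective R P0]
    (d : P1 →ₗ[R] P0) (π : P0 →ₗ[R] W) (hd : Function.Exact d π) (hπ : Function.Surjective π)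
    (q : Module.Dual R P0 →ₗ[R] E) (hq : Function.Surjective q) (i : E →ₗ[R] F)
    (hi : Function.Injective i) (e : F →ₗ[R] Module.Dual R P1) (he : e ∘ₗ i ∘ₗ q = d.dualMap)
    (hei : Function.Injective e)
    (hfac : ∀ φ : W →ₗ[R] N, φ ∈ LinearMap.range (dualTensorHom R W N)) :
    Function.Injective (i.rTensor N) := by
  rw [injective_iff_map_eq_zero]
  intro u hu
  obtain ⟨z, rfl⟩ := LinearMap.rTensor_surjective N hq u
  have hu2 : d.dualMap.rTensor N z = 0 := by
    rw [← he, LinearMap.rTensor_comp, LinearMap.rTensor_comp, LinearMap.comp_apply,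
      LinearMap.comp_apply, hu, map_zero]
  have h1 : dualTensorHom R P0 N z ∘ₗ d = 0 := by
    have := LinearMap.congr_fun (dualTensorHom_comp_rTensor_dualMap (R := R) (P := N) d) z
    simp only [LinearMap.comp_apply] at this
    rw [hu2, map_zero] at this
    exact this.symm
  obtain ⟨φ, hφ⟩ : ∃ φ : W →ₗ[R] N, φ ∘ₗ π = dualTensorHom R P0 N z :=
    factor_surj π hπ d hd _ h1
  obtain ⟨w, rfl⟩ := hfac φ
  have hz : z = π.dualMap.rTensor N w := by
    apply (dualTensorHom_bijective (R := R) (M := P0) (N := N)).1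
    rw [← hφ]
    exact (LinearMap.congr_fun (dualTensorHom_comp_rTensor_dualMap (R := R) (P := N) π) w).symm
  rw [hz, ← LinearMap.comp_apply, ← LinearMap.rTensor_comp]
  have : q ∘ₗ π.dualMap = 0 := by
    ext α
    apply hi
    apply hei
    have := LinearMap.congr_fun he (π.dualMap α)
    refine this.trans ?_
    simp only [LinearMap.zero_apply, map_zero]
    ext x
    change α (π (d x)) = 0
    rw [hd.apply_apply_eq_zero, map_zero]
  rw [this, LinearMap.rTensor_zero, LinearMap.zero_apply]

lemma transpose_two [Module.Finite R P0] [Module.Projective R P0] [Module.Finite R P1]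
    [Module.Projective R P1]
    (d : P1 →ₗ[R] P0) (π : P0 →ₗ[R] W) (hd : Function.Exact d π) (hπ : Function.Surjective π)
    (q : Module.Dual R P0 →ₗ[R] E) (hq : Function.Surjective q) (i : E →ₗ[R] F)
    (hi : Function.Injective i) (e : F ≃ₗ[R] Module.Dual R P1)
    (he : e.toLinearMap ∘ₗ i ∘ₗ q = d.dualMap)
    (hinj : Function.Injective (i.rTensor W)) :
    Module.Projective R W := by
  obtain ⟨z, hz⟩ := (dualTensorHom_bijective (R := R) (M := P0) (N := W)).2 π
  have h1 : q.rTensor W z = 0 := by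
    apply hinj
    apply (LinearEquiv.rTensor W e).injective
    rw [map_zero, map_zero]
    change (e.toLinearMap.rTensor W) _ = 0
    rw [← LinearMap.comp_apply, ← LinearMap.comp_apply, ← LinearMap.rTensor_comp,
      ← LinearMap.rTensor_comp, LinearMap.comp_assoc, he]
    apply (dualTensorHom_bijective (R := R) (M := P1) (N := W)).1
    have := LinearMap.congr_fun (dualTensorHom_comp_rTensor_dualMap (R := R) (P := W) d) z
    simp only [LinearMap.comp_apply] at this
    rw [hz] at this
    refine this.trans ?_
    rw [map_zero]
    ext x
    exact hd.apply_apply_eq_zero x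
  have hex : Function.Exact π.dualMap q := by
    intro α
    have hα := LinearMap.congr_fun he α
    simp only [LinearMap.comp_apply, LinearEquiv.coe_coe] at hα
    constructor
    · intro h
      rw [h, map_zero, map_zero] at hα
      obtain ⟨φ, hφ⟩ := factor_surj π hπ d hd α hα.symm
      exact ⟨φ, hφ⟩
    · rintro ⟨a, rfl⟩
      apply hi
      apply e.injective
      rw [hα, map_zero, map_zero]
      ext x
      change a (π (d x)) = 0
      rw [hd.apply_apply_eq_zero, map_zero]
  obtain ⟨w, hw⟩ := (rTensor_exact W hex hq z).1 h1
  refine Module.Projective.of_one_mem_range_dualTensorHom ⟨w, ?_⟩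
  have := LinearMap.congr_fun (dualTensorHom_comp_rTensor_dualMap (R := R) (P := W) π) w
  simp only [LinearMap.comp_apply] at this
  rw [hw, hz] at this
  ext x
  obtain ⟨y, rfl⟩ := hπ x
  exact (LinearMap.congr_fun this y).symm

end Part5

section Final

variable {R}

open TensorProduct

lemma main_pd [IsNoetherianRing R] [IsLocalRing R]
    (M N : ModuleCat.{0} R) [Module.Finite R M] [Module.Finite R N] (hrt : RigidTest R N)
    (n : ℕ) (hn : depth R N ≤ (n : ℕ∞)) (h : Subsingleton (Abelian.Ext.{0} M N n)) :
    HasProjectiveDimensionLT M (n + 1) := by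
  obtain ⟨W, hWf, hW⟩ := syz_exists M n
  obtain ⟨a, π, hπ⟩ := Module.Finite.exists_fin' R W
  obtain ⟨c, d', hd'⟩ := Module.Finite.exists_fin' R (LinearMap.ker π)
  let d : (Fin c → R) →ₗ[R] (Fin a → R) := (LinearMap.ker π).subtype ∘ₗ d'
  have hd : Function.Exact d π := by
    intro x
    constructor
    · intro hx
      obtain ⟨y, hy⟩ := hd' ⟨x, hx⟩
      exact ⟨y, congrArg Subtype.val hy⟩
    · rintro ⟨y, rfl⟩
      exact (d' y).2
  let e : (Fin c → R) ≃ₗ[R] Module.Dual R (Fin c → R) := (Pi.basisFun R (Fin c)).toDualEquiv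
  let D : Module.Dual R (Fin a → R) →ₗ[R] (Fin c → R) := e.symm.toLinearMap ∘ₗ d.dualMap
  let q := D.rangeRestrict
  have hq : Function.Surjective q := LinearMap.surjective_rangeRestrict D
  let i := (LinearMap.range D).subtype
  have hi : Function.Injective i := Subtype.val_injective
  have he : e.toLinearMap ∘ₗ i ∘ₗ q = d.dualMap := by
    refine LinearMap.ext fun x => ?_
    exact e.apply_symm_apply _
  let X := (Fin c → R) ⧸ LinearMap.range D
  have hS : (ShortComplex.mk (ModuleCat.ofHom i) (ModuleCat.ofHom (LinearMap.range D).mkQ)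
      (by ext y; exact (LinearMap.exact_subtype_mkQ _).apply_apply_eq_zero y)).ShortExact :=
    ModuleCat.shortComplex_shortExact _ (LinearMap.exact_subtype_mkQ _) hi
      (Submodule.mkQ_surjective _)
  have hP := proj_pi (R := R) c
  have h1 : Function.Injective (i.rTensor N) :=
    transpose_one d π hd hπ q hq i hi e.toLinearMap he e.injective (syz_factor hW N h)
  have h2 : Subsingleton (tor R 1 N (ModuleCat.of R X)) :=
    (tor_one N _ _ _ hS).2 ((LinearMap.lTensor_inj_iff_rTensor_inj _ _).2 h1)
  have h3 := pd_le_depth N hrt n hn X h2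
  have h4 : Function.Injective (i.rTensor W) :=
    syz_tor hW _ _ _ i (LinearMap.range D).mkQ hi (LinearMap.exact_subtype_mkQ _)
      (Submodule.mkQ_surjective _) h3
  have h5 := transpose_two d π hd hπ q hq i hi e he h4
  exact syz_pd hW 0 (projective_iff_hasProjectiveDimensionLT_one.1
    ((IsProjective.iff_projective (R := R) W).1 h5))

end Final


/-- if `N` is a rigid-test module and `Ext^n_R(M,N) = 0` for some
`n ≥ depth N`, then `pd M ≤ n - 1` and `pd M = sup {i | Ext^i(M,N) ≠ 0}`. -/
theorem stmt8 [IsNoetherianRing R] [IsLocalRing R]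
    (M N : ModuleCat R) [Module.Finite R M] [Module.Finite R N]
    (hM : Nontrivial M) (hN : Nontrivial N) (hrt : RigidTest R N)
    (n : ℕ) (hn : depth R N ≤ (n : ℕ∞))
    (h : Subsingleton (ext R n M N)) :
    projDim R M < (n : ℕ∞) ∧
    projDim R M = sSup {i : ℕ∞ | ∃ j : ℕ, i = j ∧ ¬ Subsingleton (ext R j M N)} := by
  classical
  rw [ext_sub_iff] at h
  have h1 := pd_drop M N hN n (main_pd M N hrt n hn h) h
  have h0 : ¬ HasProjectiveDimensionLT M 0 := fun h0 =>
    not_subsingleton M (ModuleCat.isZero_iff_subsingleton.1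
      (isZero_of_hasProjectiveDimensionLT_zero M))
  have hex : ∃ q, HasProjectiveDimensionLT M q := ⟨n, h1⟩
  obtain ⟨p, hp⟩ : ∃ p, Nat.find hex = p + 1 := by
    refine Nat.exists_eq_succ_of_ne_zero fun hz => h0 ?_
    rw [← hz]
    exact Nat.find_spec hex
  have hp1 : HasProjectiveDimensionLT M (p + 1) := hp ▸ Nat.find_spec hex
  have hp2 : ¬ HasProjectiveDimensionLT M p := Nat.find_min hex (by omega)
  have hpn : p < n := by
    have := Nat.find_min' hex h1
    omega
  have hpd : projDim R M = p := by
    refine le_antisymm ((pd_le_iff M p).2 hp1) ?_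
    by_contra! hlt
    obtain ⟨r, hr⟩ := ENat.ne_top_iff_exists.1 (ne_top_of_lt hlt)
    rw [← hr] at hlt
    have hrp : r < p := by exact_mod_cast hlt
    have := (pd_le_iff M r).1 hr.ge
    exact hp2 (hasProjectiveDimensionLT_of_ge M (r + 1) p hrp)
  refine ⟨by rw [hpd]; exact_mod_cast hpn, ?_⟩
  rw [hpd]
  refine le_antisymm (le_sSup ⟨p, rfl, fun hs => ?_⟩) (sSup_le ?_)
  · rw [ext_sub_iff] at hs
    exact hp2 (pd_drop M N hN p hp1 hs)
  · rintro a ⟨j, rfl, hj⟩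
    by_contra! hlt
    rw [ext_sub_iff] at hj
    have hpj : p < j := by exact_mod_cast hlt
    exact hj (HasProjectiveDimensionLT.subsingleton M (p + 1) j hpj N)
end
end

section
/- Let R be an Artinian commutative local ring and let M and N be nonzero finitely generated R-modules. If M is strongly-rigid and Ext_R^n(M,N) = 0 for some n ≥ 0, then N is injective. -/
open CategoryTheory

noncomputable section

variable (R : Type) [CommRing R]

theorem exists_inj_hull (R : Type) [CommRing R] [IsLocalRing R] :
    ∃ (E : Type) (_ : AddCommGroup E) (_ : Module R E) (_ : Module.Injective R E)
      (S : Submodule R E), IsSimpleModule R S ∧ ∀ x : E, x ≠ 0 → S ≤ Submodule.span R {x} := by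
  let k := ModuleCat.of R (IsLocalRing.ResidueField R)
  let I : ModuleCat R := Injective.under k
  have hI : Module.Injective R I := by
    have : Injective (ModuleCat.of R I) := (Injective.injective_under k : Injective I)
    exact Module.injective_module_of_injective_object R I
  let ι : k ⟶ I := Injective.ι k
  have hι : Function.Injective ι.hom := (ModuleCat.mono_iff_injective ι).1 inferInstance
  have hk : IsSimpleModule R k :=
    isSimpleModule_iff_quot_maximal.2 ⟨IsLocalRing.maximalIdeal R, inferInstance,
      ⟨LinearEquiv.refl R (R ⧸ IsLocalRing.maximalIdeal R)⟩⟩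
  let S : Submodule R I := LinearMap.range ι.hom
  have hS : IsSimpleModule R S := IsSimpleModule.congr (LinearEquiv.ofInjective ι.hom hι).symm
  have hSat : IsAtom S := isSimpleModule_iff_isAtom.1 hS
  obtain ⟨V, hSV, hV⟩ := zorn_le_nonempty₀
    {V : Submodule R I | ∀ x ∈ V, x ≠ 0 → S ≤ Submodule.span R {x}} (by
      intro c hc hch y hy
      refine ⟨sSup c, ?_, fun z hz => le_sSup hz⟩
      intro x hx hx0
      obtain ⟨z, hz, hxz⟩ := (Submodule.mem_sSup_of_directed ⟨y, hy⟩ hch.directedOn).1 hx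
      exact hc hz x hxz hx0) S (by
      intro x hx hx0
      have hle : Submodule.span R {x} ≤ S := by simpa using hx
      rcases hSat.le_iff.1 hle with h | h
      · simp at h; exact absurd h hx0
      · exact h.ge)
  obtain ⟨W, -, hW⟩ := zorn_le_nonempty₀
    {W : Submodule R I | ∀ x ∈ W, x ∈ V → x = 0} (by
      intro c hc hch y hy
      refine ⟨sSup c, ?_, fun z hz => le_sSup hz⟩
      intro x hx hx0
      obtain ⟨z, hz, hxz⟩ := (Submodule.mem_sSup_of_directed ⟨y, hy⟩ hch.directedOn).1 hx
      exact hc hz x hxz hx0) ⊥ (by intro x hx _; simpa using hx)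
  obtain ⟨φ, hφ⟩ := hI.out (W.mkQ ∘ₗ V.subtype) (by
    rw [← LinearMap.ker_eq_bot, LinearMap.ker_eq_bot']
    rintro ⟨v, hv⟩ h
    simp at h
    simpa using hW.prop v h hv) V.subtype
  have hφ' : ∀ v ∈ V, φ (W.mkQ v) = v := fun v hv => hφ ⟨v, hv⟩
  have hmeet : ∀ x ∉ W, ∃ v ∈ V, v ≠ 0 ∧ ∃ w ∈ W, ∃ r : R, v = w + r • x := by
    intro x hx
    by_contra hcon
    push Not at hcon
    have : W ⊔ Submodule.span R {x} ≤ W := hW.le_of_ge (by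
      intro y hy hyV
      by_contra hy0
      obtain ⟨w, hw, z, hz, rfl⟩ := Submodule.mem_sup.1 hy
      obtain ⟨r, rfl⟩ := Submodule.mem_span_singleton.1 hz
      exact hcon _ hyV hy0 w hw r rfl) le_sup_left
    exact hx (this (Submodule.mem_sup_right (Submodule.mem_span_singleton_self x)))
  have hVr : LinearMap.range φ ≤ V := hV.le_of_ge (by
      rintro _ ⟨q, rfl⟩ h0
      obtain ⟨x, rfl⟩ := W.mkQ_surjective q
      have hx : x ∉ W := by
        intro hx
        exact h0 (by rw [(Submodule.Quotient.mk_eq_zero W).2 hx |> (fun h => (h : W.mkQ x = 0)), map_zero])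
      obtain ⟨v, hv, hv0, w, hw, r, hr⟩ := hmeet x hx
      have h1 : v = r • φ (W.mkQ x) := by
        have := hφ' v hv
        rw [← this, ← map_smul, ← map_smul]
        congr 1
        rw [hr, map_add, (Submodule.Quotient.mk_eq_zero W).2 hw |> (fun h => (h : W.mkQ w = 0)), zero_add]
      refine (hV.prop v hv hv0).trans ?_
      rw [Submodule.span_singleton_le_iff_mem, h1]
      exact Submodule.smul_mem _ _ (Submodule.mem_span_singleton_self _)) (by
      intro v hv
      exact ⟨_, hφ' v hv⟩)
  let ρ : I →ₗ[R] V := LinearMap.codRestrict V (φ ∘ₗ W.mkQ) (fun x => hVr ⟨_, rfl⟩)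
  have hρ : ∀ v : V, ρ v = v := fun v => Subtype.ext (hφ' v v.2)
  refine ⟨V, inferInstance, inferInstance, ⟨?_⟩, S.comap V.subtype, ?_, ?_⟩
  · intro A B _ _ _ _ f hf g
    obtain ⟨h, hh⟩ := hI.out f hf (V.subtype ∘ₗ g)
    exact ⟨ρ ∘ₗ h, fun x => by simp [hh, hρ]⟩
  · exact IsSimpleModule.congr (Submodule.comapSubtypeEquivOfLe hSV)
  · rintro ⟨x, hx⟩ hx0 ⟨y, hy⟩ hyS
    have : y ∈ Submodule.span R {x} := hV.prop x hx (by simpa using hx0) hyS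
    obtain ⟨r, hr⟩ := Submodule.mem_span_singleton.1 this
    exact Submodule.mem_span_singleton.2 ⟨r, Subtype.ext hr⟩

section dual
variable {R : Type} [CommRing R] {E : Type} [AddCommGroup E] [Module R E]
  [hE : Module.Injective R E] {S : Submodule R E}

/-- `E` cogenerates. -/
theorem cogen [IsLocalRing R] (hS : IsSimpleModule R S) {Q : Type} [AddCommGroup Q] [Module R Q]
    (q : Q) (hq : q ≠ 0) : ∃ h : Q →ₗ[R] E, h q ≠ 0 := by
  have : Nontrivial S := IsSimpleModule.nontrivial R S
  obtain ⟨s, hs⟩ := exists_ne (0 : S)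
  have hker : LinearMap.ker (LinearMap.toSpanSingleton R Q q) ≤
      LinearMap.ker (LinearMap.toSpanSingleton R E (s : E)) := by
    have hmax : Ideal.IsMaximal (LinearMap.ker (LinearMap.toSpanSingleton R S s)) :=
      IsSimpleModule.ker_toSpanSingleton_isMaximal R hs
    intro r hr
    have : r ∈ LinearMap.ker (LinearMap.toSpanSingleton R S s) := by
      rw [IsLocalRing.eq_maximalIdeal hmax, IsLocalRing.mem_maximalIdeal]
      rintro ⟨u, rfl⟩
      simp only [LinearMap.mem_ker, LinearMap.toSpanSingleton_apply] at hr
      exact hq ((smul_eq_zero_iff_eq u).1 hr)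
    simp only [LinearMap.mem_ker, LinearMap.toSpanSingleton_apply] at this ⊢
    rw [← S.coe_smul, this]; rfl
  let K := LinearMap.ker (LinearMap.toSpanSingleton R Q q)
  let f : (R ⧸ K) →ₗ[R] Q := K.liftQ (LinearMap.toSpanSingleton R Q q) le_rfl
  let g : (R ⧸ K) →ₗ[R] E := K.liftQ (LinearMap.toSpanSingleton R E (s : E)) hker
  obtain ⟨h, hh⟩ := hE.out f (LinearMap.ker_eq_bot.1 (Submodule.ker_liftQ_eq_bot' _ _ rfl)) g
  refine ⟨h, ?_⟩
  have h1 := hh (K.mkQ 1)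
  have h2 : f (K.mkQ 1) = q := (LinearMap.toSpanSingleton_apply_one R Q q)
  have h3 : g (K.mkQ 1) = s := (LinearMap.toSpanSingleton_apply_one R E (s : E))
  rw [h2, h3] at h1
  rw [h1]
  simpa using hs

theorem length_dual_simple (hS : IsSimpleModule R S)
    (hS' : ∀ x : E, x ≠ 0 → S ≤ Submodule.span R {x}) (T : Type) [AddCommGroup T] [Module R T]
    [IsSimpleModule R T] : Module.length R (T →ₗ[R] E) ≤ 1 := by
  have : Nontrivial T := IsSimpleModule.nontrivial R T
  obtain ⟨t, ht⟩ := exists_ne (0 : T)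
  have hmem : ∀ f : T →ₗ[R] E, f t ∈ S := by
    intro f
    rcases LinearMap.injective_or_eq_zero f with hf | rfl
    · have hr : IsSimpleModule R (LinearMap.range f) :=
        IsSimpleModule.congr (LinearEquiv.ofInjective f hf).symm
      have hat : IsAtom (LinearMap.range f) := isSimpleModule_iff_isAtom.1 hr
      have hle : S ≤ LinearMap.range f := by
        refine (hS' (f t) (fun h => ht (hf (by simpa using h)))).trans ?_
        simp
      rcases hat.le_iff.1 hle with h | h
      · exact absurd h (isSimpleModule_iff_isAtom.1 hS).1
      · rw [h]; exact ⟨t, rfl⟩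
    · simp
  let ev : (T →ₗ[R] E) →ₗ[R] S := LinearMap.codRestrict S (LinearMap.applyₗ t) hmem
  have hev : Function.Injective ev := by
    rw [← LinearMap.ker_eq_bot, LinearMap.ker_eq_bot']
    intro f hf
    have h0 : f t = 0 := congrArg Subtype.val hf
    rcases LinearMap.injective_or_eq_zero f with h | h
    · exact absurd (h (by simpa using h0)) ht
    · exact h
  calc _ ≤ Module.length R S := Module.length_le_of_injective ev hev
    _ = 1 := Module.length_eq_one_iff.2 hS

theorem length_dual_le (hS : IsSimpleModule R S)
    (hS' : ∀ x : E, x ≠ 0 → S ≤ Submodule.span R {x}) (N : Type) [AddCommGroup N] [Module R N]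
    (hN : IsFiniteLength R N) : Module.length R (N →ₗ[R] E) ≤ Module.length R N := by
  induction hN with
  | of_subsingleton => simp
  | @of_simple_quotient M _ _ K hK _ ih =>
    let f : ((M ⧸ K) →ₗ[R] E) →ₗ[R] (M →ₗ[R] E) := LinearMap.lcomp R E K.mkQ
    let g : (M →ₗ[R] E) →ₗ[R] (K →ₗ[R] E) := LinearMap.lcomp R E K.subtype
    have hg : Function.Surjective g := by
      intro u
      obtain ⟨h, hh⟩ := hE.out K.subtype K.subtype_injective u
      exact ⟨h, LinearMap.ext hh⟩
    have hf : Function.Injective f := by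
      intro a b hab
      exact Submodule.linearMap_qext _ hab
    have hex : Function.Exact f g := by
      intro u
      constructor
      · intro hu
        refine ⟨K.liftQ u (fun x hx => ?_), ?_⟩
        · exact LinearMap.congr_fun hu ⟨x, hx⟩
        · ext x; rfl
      · rintro ⟨v, rfl⟩
        ext x
        change v (K.mkQ x) = 0
        rw [(Submodule.Quotient.mk_eq_zero K).2 x.2 |> (fun h => (h : K.mkQ x = 0)), map_zero]
    rw [Module.length_eq_add_of_exact f g hf hg hex,
      Module.length_eq_add_of_exact K.subtype K.mkQ K.subtype_injective K.mkQ_surjective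
        (LinearMap.exact_subtype_mkQ K), add_comm,
        Module.length_eq_one_iff.2 hK]
    exact add_le_add ih (length_dual_simple hS hS' _)

theorem finite_dual (hS : IsSimpleModule R S)
    (hS' : ∀ x : E, x ≠ 0 → S ≤ Submodule.span R {x}) (N : Type) [AddCommGroup N] [Module R N]
    (hN : IsFiniteLength R N) : IsFiniteLength R (N →ₗ[R] E) := by
  rw [← Module.length_ne_top_iff] at hN ⊢
  exact ne_top_of_le_ne_top hN (length_dual_le hS hS' N (Module.length_ne_top_iff.1 hN))

theorem bidual [IsLocalRing R] (hS : IsSimpleModule R S)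
    (hS' : ∀ x : E, x ≠ 0 → S ≤ Submodule.span R {x}) (N : Type) [AddCommGroup N] [Module R N]
    (hN : IsFiniteLength R N) : Nonempty (N ≃ₗ[R] ((N →ₗ[R] E) →ₗ[R] E)) := by
  let e : N →ₗ[R] ((N →ₗ[R] E) →ₗ[R] E) := LinearMap.applyₗ
  have he : Function.Injective e := by
    rw [← LinearMap.ker_eq_bot, LinearMap.ker_eq_bot']
    intro x hx
    by_contra hx0
    obtain ⟨h, hh⟩ := cogen (E := E) hS x hx0
    exact hh (LinearMap.congr_fun hx h)
  have h1 := finite_dual hS hS' N hN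
  have h2 := finite_dual hS hS' _ h1
  have hlen : Module.length R ((N →ₗ[R] E) →ₗ[R] E) ≤ Module.length R N :=
    (length_dual_le hS hS' _ h1).trans (length_dual_le hS hS' _ hN)
  obtain ⟨_, _⟩ := isFiniteLength_iff_isNoetherian_isArtinian.1 h2
  have hsurj : LinearMap.range e = ⊤ := by
    by_contra hne
    have := Submodule.length_lt hne
    rw [← (LinearEquiv.ofInjective e he).length_eq] at this
    exact absurd this (not_lt.2 hlen)
  exact ⟨LinearEquiv.ofBijective e ⟨he, LinearMap.range_eq_top.1 hsurj⟩⟩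

theorem injective_dual (P : Type) [AddCommGroup P] [Module R P] [Module.Flat R P] :
    Module.Injective R (P →ₗ[R] E) := by
  constructor
  intro A B _ _ _ _ f hf g
  obtain ⟨h, hh⟩ := hE.out (LinearMap.rTensor P f) (Module.Flat.rTensor_preserves_injective_linearMap f hf)
    (TensorProduct.lift g)
  refine ⟨TensorProduct.curry h, fun x => ?_⟩
  ext p
  simpa using hh (x ⊗ₜ p)

end dual

theorem exists_residue_emb (R : Type) [CommRing R] [IsLocalRing R] (N : Type) [AddCommGroup N]
    [Module R N] [IsArtinian R N] [Nontrivial N] :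
    ∃ f : IsLocalRing.ResidueField R →ₗ[R] N, Function.Injective f := by
  obtain ⟨S, hS, -⟩ := (eq_bot_or_exists_atom_le (⊤ : Submodule R N)).resolve_left top_ne_bot
  obtain ⟨I, hI, ⟨e⟩⟩ := isSimpleModule_iff_quot_maximal.1 (isSimpleModule_iff_isAtom.2 hS)
  obtain rfl := IsLocalRing.eq_maximalIdeal hI
  exact ⟨S.subtype ∘ₗ e.symm.toLinearMap, S.subtype_injective.comp e.symm.injective⟩

theorem exists_residue_quot (R : Type) [CommRing R] [IsLocalRing R] (N : Type) [AddCommGroup N]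
    [Module R N] [Module.Finite R N] [Nontrivial N] :
    ∃ f : N →ₗ[R] IsLocalRing.ResidueField R, Function.Surjective f := by
  obtain ⟨S, hS, -⟩ := (eq_top_or_exists_le_coatom (⊥ : Submodule R N)).resolve_left bot_ne_top
  obtain ⟨I, hI, ⟨e⟩⟩ := isSimpleModule_iff_quot_maximal.1 (isSimpleModule_iff_isCoatom.2 hS)
  obtain rfl := IsLocalRing.eq_maximalIdeal hI
  exact ⟨e.toLinearMap ∘ₗ S.mkQ, e.surjective.comp S.mkQ_surjective⟩

theorem exists_hom_ne_zero (R : Type) [CommRing R] [IsLocalRing R] (M N : Type) [AddCommGroup N]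
    [Module R N] [IsArtinian R N] [Nontrivial N] [AddCommGroup M]
    [Module R M] [Module.Finite R M] [Nontrivial M] : ∃ f : M →ₗ[R] N, f ≠ 0 := by
  obtain ⟨f, hf⟩ := exists_residue_emb R N
  obtain ⟨g, hg⟩ := exists_residue_quot R M
  obtain ⟨x, hx⟩ := hg 1
  refine ⟨f ∘ₗ g, fun h => ?_⟩
  have := LinearMap.congr_fun h x
  simp only [LinearMap.comp_apply, hx, LinearMap.zero_apply] at this
  exact one_ne_zero (hf (by simpa using this))

theorem free_of_pd (R : Type) [CommRing R] [IsArtinianRing R] [IsLocalRing R] (n : ℕ) :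
    ∀ (X : ModuleCat.{0} R) [Module.Finite R X] [HasProjectiveDimensionLT X (n + 1)],
      Module.Projective R X := by
  induction n with
  | zero =>
    intro X _ hX
    have : HasProjectiveDimensionLT X 1 := hX
    have : Projective X := projective_iff_hasProjectiveDimensionLT_one.2 this
    exact (IsProjective.iff_projective X).2 this
  | succ n ih =>
    intro X _ hX
    obtain ⟨m, g, hg⟩ := Module.Finite.exists_fin' R X
    let F := ModuleCat.of R (Fin m → R)
    let K := ModuleCat.of R (LinearMap.ker g)
    let S : ShortComplex (ModuleCat.{0} R) := ShortComplex.mk (X₁ := K) (X₂ := F) (X₃ := X)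
      (ModuleCat.ofHom (LinearMap.ker g).subtype) (ModuleCat.ofHom g) (by
        ext x; exact x.2)
    have hS : S.ShortExact :=
      { exact := (ShortComplex.ShortExact.moduleCat_exact_iff_function_exact S).2
          (LinearMap.exact_subtype_ker_map g)
        mono_f := (ModuleCat.mono_iff_injective _).2 (Submodule.subtype_injective _)
        epi_g := (ModuleCat.epi_iff_surjective _).2 hg }
    have hFp : Projective F := (IsProjective.iff_projective F).1
      (inferInstanceAs (Module.Projective R (Fin m → R)))
    have hK : HasProjectiveDimensionLT K (n + 1) :=
      (hS.hasProjectiveDimensionLT_X₃_iff n hFp).1 hX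
    have hKf : Module.Finite R K := inferInstanceAs (Module.Finite R (LinearMap.ker g))
    have hKp : Module.Projective R (LinearMap.ker g) := ih K
    obtain ⟨σ, hσ⟩ := exists_residue_emb R R
    have hinj : Function.Injective ((LinearMap.ker g).subtype.lTensor (IsLocalRing.ResidueField R)) := by
      have h1 : Function.Injective ((LinearMap.ker g).subtype.lTensor R ∘ₗ
          σ.rTensor (LinearMap.ker g)) :=
        (Module.Flat.lTensor_preserves_injective_linearMap _ (Submodule.subtype_injective _)).comp
          (Module.Flat.rTensor_preserves_injective_linearMap _ hσ)
      rw [LinearMap.lTensor_comp_rTensor, ← LinearMap.rTensor_comp_lTensor] at h1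
      exact Function.Injective.of_comp h1
    have := Module.free_of_lTensor_residueField_injective (LinearMap.ker g).subtype g hg
      (LinearMap.exact_subtype_ker_map g) hinj
    infer_instance
theorem subsing_iff_exactAt {R : Type} [CommRing R] {ι : Type} {c : ComplexShape ι}
    (K : HomologicalComplex (ModuleCat.{0} R) c) (i j k : ι) (hi : c.prev j = i) (hk : c.next j = k)
    (A : ModuleCat.{0} R) (e : A ≅ K.homology j) :
    Subsingleton A ↔ ∀ x : K.X j, (K.d j k).hom x = 0 → ∃ y : K.X i, (K.d i j).hom y = x := by
  rw [← ModuleCat.isZero_iff_subsingleton, e.isZero_iff, ← K.exactAt_iff_isZero_homology,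
    K.exactAt_iff' i j k hi hk, ShortComplex.moduleCat_exact_iff]
  rfl

theorem ext_succ_iff (R : Type) [CommRing R] (n : ℕ) (M N : ModuleCat.{0} R) :
    Subsingleton (ext R (n + 1) M N) ↔ Subsingleton (Abelian.Ext.{0} M N (n + 1)) := by
  let P := projectiveResolution M
  rw [subsing_iff_exactAt _ n (n + 1) (n + 2) (by simp) (by simp) _
    (P.isoExt (R := R) (n + 1) N)]
  have key : (∀ f : P.complex.X (n + 1) ⟶ N, P.complex.d (n + 2) (n + 1) ≫ f = 0 →
      ∃ g : P.complex.X n ⟶ N, P.complex.d (n + 1) n ≫ g = f) ↔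
      Subsingleton (Abelian.Ext.{0} M N (n + 1)) := by
    constructor
    · intro h
      refine subsingleton_of_forall_eq 0 fun α => ?_
      obtain ⟨f, hf, rfl⟩ := P.extMk_surjective α (n + 2) rfl
      exact (P.extMk_eq_zero_iff f (n + 2) rfl hf n rfl).2 (h f hf)
    · intro h f hf
      exact (P.extMk_eq_zero_iff f (n + 2) rfl hf n rfl).1 (Subsingleton.elim _ _)
  rw [← key]
  rfl

/-- The augmentation of a projective resolution. -/
noncomputable def augm {R : Type} [CommRing R] {X : ModuleCat.{0} R} (P : ProjectiveResolution X) :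
    P.complex.X 0 ⟶ X := P.π.f 0

theorem augm_surj {R : Type} [CommRing R] {X : ModuleCat.{0} R} (P : ProjectiveResolution X) :
    Function.Surjective (augm P).hom :=
  (ModuleCat.epi_iff_surjective (P.π.f 0)).1 inferInstance

theorem d_augm {R : Type} [CommRing R] {X : ModuleCat.{0} R} (P : ProjectiveResolution X) :
    P.complex.d 1 0 ≫ augm P = 0 := P.complex_d_comp_π_f_zero

theorem exact_augm {R : Type} [CommRing R] {X : ModuleCat.{0} R} (P : ProjectiveResolution X) :
    Function.Exact (P.complex.d 1 0).hom (augm P).hom :=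
  (ShortComplex.ShortExact.moduleCat_exact_iff_function_exact _).1 P.exact₀

theorem augm_cancel {R : Type} [CommRing R] {X Y : ModuleCat.{0} R} (P : ProjectiveResolution X)
    (f g : X ⟶ Y) (h : augm P ≫ f = augm P ≫ g) : f = g := by
  ext x
  obtain ⟨y, rfl⟩ := augm_surj P x
  exact LinearMap.congr_fun (congrArg ModuleCat.Hom.hom h) y

theorem ext_zero (R : Type) [CommRing R] (M N : ModuleCat.{0} R)
    (h : Subsingleton (ext R 0 M N)) (f : M ⟶ N) : f = 0 := by
  let P := projectiveResolution M
  rw [subsing_iff_exactAt _ 0 0 1 (by simp) (by simp) _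
    (P.isoExt (R := R) 0 N)] at h
  have h' : ∀ f : P.complex.X 0 ⟶ N, P.complex.d 1 0 ≫ f = 0 →
      ∃ g : P.complex.X 0 ⟶ N, P.complex.d 0 0 ≫ g = f := h
  obtain ⟨g, hg⟩ := h' (augm P ≫ f) (by
    rw [← Category.assoc, d_augm, Limits.zero_comp])
  rw [P.complex.shape _ _ (by simp), Limits.zero_comp] at hg
  exact augm_cancel P _ _ (by rw [← hg, Limits.comp_zero])

theorem pd_of_projDim (R : Type) [CommRing R] (X : ModuleCat.{0} R) (h : projDim R X < ⊤) :
    ∃ n : ℕ, HasProjectiveDimensionLT X (n + 1) := by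
  obtain ⟨a, ha, hlt⟩ := sInf_lt_iff.1 h
  obtain ⟨n, rfl⟩ := ENat.ne_top_iff_exists.1 hlt.ne
  refine ⟨n, (hasProjectiveDimensionLT_iff.{0} X (n + 1)).2 ?_⟩
  intro i hi Y e
  obtain ⟨i, rfl⟩ : ∃ j, i = j + 1 := ⟨i - 1, by omega⟩
  have := (ext_succ_iff R i X Y).1 (ha (i + 1) Y (by exact_mod_cast hi))
  exact Subsingleton.elim _ _

section res
variable {R : Type} [CommRing R] (E : ModuleCat.{0} R) [hE : Module.Injective R E]
  {X : ModuleCat.{0} R} (P : ProjectiveResolution X)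

theorem injective_hom (Q : ModuleCat.{0} R) [hQ : Projective Q] :
    Module.Injective R (Q ⟶ E) := by
  have : Module.Projective R Q := (IsProjective.iff_projective Q).2 hQ
  have h : Module.Injective R (Q →ₗ[R] E) := injective_dual _
  rw [← Module.Baer.iff_injective] at h ⊢
  exact h.of_equiv (ModuleCat.homLinearEquiv (S := R)).symm

/-- the injective extension property for morphisms -/
theorem ext_along {A B : ModuleCat.{0} R} (i : A ⟶ B) [Mono i] (f : A ⟶ E) : ∃ g, i ≫ g = f := by
  obtain ⟨h, hh⟩ := hE.out i.hom ((ModuleCat.mono_iff_injective i).1 inferInstance) f.hom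
  exact ⟨ModuleCat.ofHom h, by ext x; exact hh x⟩

theorem exact_ext {A B C : ModuleCat.{0} R} (i : A ⟶ B) (p : B ⟶ C)
    (hex : Function.Exact i.hom p.hom) (f : B ⟶ E) (hf : i ≫ f = 0) : ∃ g, p ≫ g = f := by
  have hker : LinearMap.ker p.hom ≤ LinearMap.ker f.hom := by
    intro x hx
    obtain ⟨y, rfl⟩ := (hex x).1 hx
    exact LinearMap.congr_fun (congrArg ModuleCat.Hom.hom hf) y
  obtain ⟨h, hh⟩ := hE.out ((LinearMap.ker p.hom).liftQ p.hom le_rfl)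
    (LinearMap.ker_eq_bot.1 (Submodule.ker_liftQ_eq_bot' _ _ rfl))
    ((LinearMap.ker p.hom).liftQ f.hom hker)
  exact ⟨ModuleCat.ofHom h, by ext x; exact hh ((LinearMap.ker p.hom).mkQ x)⟩

theorem dual_aug_comp : (ModuleCat.ofHom (Linear.leftComp R E (augm P)) :
    ModuleCat.of R (X ⟶ E) ⟶ (P.complex.linearYonedaObj R E).X 0) ≫
      (P.complex.linearYonedaObj R E).d 0 1 = 0 := by
  ext (f : X ⟶ E)
  change P.complex.d 1 0 ≫ augm P ≫ f = 0
  rw [← Category.assoc, d_augm, Limits.zero_comp]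

/-- The coaugmentation of the dual of a projective resolution. -/
noncomputable def dualAug : (CochainComplex.single₀ (ModuleCat.{0} R)).obj (ModuleCat.of R (X ⟶ E)) ⟶
    P.complex.linearYonedaObj R E :=
  (CochainComplex.fromSingle₀Equiv _ _).symm
    ⟨ModuleCat.ofHom (Linear.leftComp R E (augm P)), dual_aug_comp E P⟩

theorem dualAug_apply (f : X ⟶ E) : ((dualAug E P).f 0).hom f = augm P ≫ f := by
  have h : (dualAug E P).f 0 = ModuleCat.ofHom (Linear.leftComp R E (augm P)) :=
    CochainComplex.fromSingle₀Equiv_symm_apply_f_zero _ (dual_aug_comp E P)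
  rw [h]
  rfl

/-- The dual of a projective resolution. -/
noncomputable def dualRes : InjectiveResolution (ModuleCat.of R (X ⟶ E)) where
  cocomplex := P.complex.linearYonedaObj R E
  injective n := by
    have := injective_hom E (P.complex.X n)
    exact Module.injective_object_of_injective_module R (P.complex.X n ⟶ E)
  ι := dualAug E P
  quasiIso := ⟨fun n => by
    cases n with
    | zero =>
      rw [CochainComplex.quasiIsoAt₀_iff, ShortComplex.quasiIso_iff_of_zeros]
      · constructor
        · rw [ShortComplex.moduleCat_exact_iff]
          intro (f : P.complex.X 0 ⟶ E) hf
          obtain ⟨g, hg⟩ := exact_ext E _ _ (exact_augm P) f hf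
          exact ⟨g, (dualAug_apply E P g).trans hg⟩
        · rw [ModuleCat.mono_iff_injective]
          intro (f : X ⟶ E) (g : X ⟶ E) hfg
          exact augm_cancel P f g
            ((dualAug_apply E P f).symm.trans (Eq.trans hfg (dualAug_apply E P g)))
      · rfl
      · rfl
      · exact (P.complex.linearYonedaObj R E).shape 0 0 (by simp)
    | succ n =>
      rw [quasiIsoAt_iff_exactAt]
      · rw [HomologicalComplex.exactAt_iff' _ n (n + 1) (n + 2) (by simp) (by simp),
          ShortComplex.moduleCat_exact_iff]
        intro (f : P.complex.X (n + 1) ⟶ E) hf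
        exact exact_ext E (P.complex.d (n + 2) (n + 1)) (P.complex.d (n + 1) n)
          ((ShortComplex.ShortExact.moduleCat_exact_iff_function_exact _).1 (P.exact_succ n)) f hf
      · apply CochainComplex.exactAt_succ_single_obj⟩

open MonoidalCategory TensorProduct in
theorem tor_of_ext {S : Submodule R E} [IsLocalRing R] (hS : IsSimpleModule R S)
    (M : ModuleCat.{0} R) (n : ℕ)
    (h : Subsingleton (Abelian.Ext.{0} M (ModuleCat.of R (X ⟶ E)) (n + 1))) :
    Subsingleton (tor R (n + 1) M X) := by
  let P := projectiveResolution X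
  change Subsingleton ((((tensoringLeft (ModuleCat.{0} R)).obj M).leftDerived (n + 1)).obj X)
  rw [subsing_iff_exactAt _ (n + 2) (n + 1) n (by simp) (by simp) _
    (P.isoLeftDerivedObj ((tensoringLeft (ModuleCat R)).obj M) (n + 1))]
  intro (x : M ⊗[R] P.complex.X (n + 1)) hx
  replace hx : (P.complex.d (n + 1) n).hom.lTensor M x = 0 := hx
  change ∃ y, (P.complex.d (n + 2) (n + 1)).hom.lTensor M y = x
  by_contra hcon
  let D := LinearMap.range ((P.complex.d (n + 2) (n + 1)).hom.lTensor M)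
  have hxD : D.mkQ x ≠ 0 := by
    intro h0
    exact hcon ((Submodule.Quotient.mk_eq_zero D).1 h0)
  obtain ⟨u, hu⟩ := cogen (E := E) hS (D.mkQ x) hxD
  let h' : M ⊗[R] P.complex.X (n + 1) →ₗ[R] E := u ∘ₗ D.mkQ
  let f : M ⟶ (dualRes E P).cocomplex.X (n + 1) :=
    ModuleCat.ofHom ((ModuleCat.homLinearEquiv (S := R)).symm.toLinearMap ∘ₗ TensorProduct.curry h')
  have hf : f ≫ (dualRes E P).cocomplex.d (n + 1) (n + 2) = 0 := by
    ext m
    change P.complex.d (n + 2) (n + 1) ≫ ModuleCat.ofHom (TensorProduct.curry h' m) = 0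
    ext p
    change u (D.mkQ (m ⊗ₜ (P.complex.d (n + 2) (n + 1)).hom p)) = 0
    have : D.mkQ (m ⊗ₜ (P.complex.d (n + 2) (n + 1)).hom p) = 0 :=
      (Submodule.Quotient.mk_eq_zero D).2 ⟨m ⊗ₜ p, rfl⟩
    rw [this, map_zero]
  obtain ⟨g, hg⟩ := ((dualRes E P).extMk_eq_zero_iff f (n + 2) rfl hf n rfl).1
    (Subsingleton.elim _ _)
  let g' : M →ₗ[R] P.complex.X n →ₗ[R] E :=
    (ModuleCat.homLinearEquiv (S := R)).toLinearMap ∘ₗ g.hom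
  have : h' = TensorProduct.lift g' ∘ₗ (P.complex.d (n + 1) n).hom.lTensor M := by
    ext m p
    have h1 : P.complex.d (n + 1) n ≫ (g.hom m : P.complex.X n ⟶ E) =
        ModuleCat.ofHom (TensorProduct.curry h' m) :=
      LinearMap.congr_fun (congrArg ModuleCat.Hom.hom hg) m
    exact (LinearMap.congr_fun (congrArg ModuleCat.Hom.hom h1) p).symm
  apply hu
  change h' x = 0
  rw [this, LinearMap.comp_apply, hx, map_zero]

end res

theorem stmt10 [IsArtinianRing R] [IsLocalRing R]
    (M N : ModuleCat R) [Module.Finite R M] [Module.Finite R N]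
    (hM : Nontrivial M) (hN : Nontrivial N) (hsr : StronglyRigid R M)
    (n : ℕ) (h : Subsingleton (ext R n M N)) :
    CategoryTheory.Injective N := by
  cases n with
  | zero =>
    obtain ⟨f, hf⟩ := exists_hom_ne_zero R M N
    exact absurd (congrArg ModuleCat.Hom.hom (ext_zero R M N h (ModuleCat.ofHom f))) hf
  | succ n =>
    obtain ⟨E, _, _, hE, S, hS, hS'⟩ := exists_inj_hull R
    have hNl : IsFiniteLength R N :=
      isFiniteLength_iff_isNoetherian_isArtinian.2 ⟨inferInstance, inferInstance⟩
    obtain ⟨e⟩ := bidual hS hS' N hNl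
    let X := ModuleCat.of R (N →ₗ[R] E)
    have hX : Module.Finite R X := by
      obtain ⟨_, _⟩ := isFiniteLength_iff_isNoetherian_isArtinian.1 (finite_dual hS hS' N hNl)
      exact inferInstanceAs (Module.Finite R (N →ₗ[R] E))
    let e' : N ≅ ModuleCat.of R (X ⟶ ModuleCat.of R E) :=
      (e.trans (ModuleCat.homLinearEquiv (S := R) (M := X) (N := ModuleCat.of R E)).symm).toModuleIso
    have hEi : Module.Injective R (ModuleCat.of R E) := hE
    have h' : Subsingleton (Abelian.Ext.{0} M (ModuleCat.of R (X ⟶ ModuleCat.of R E)) (n + 1)) := by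
      rw [← ext_succ_iff, ← ModuleCat.isZero_iff_subsingleton,
        ← (((Ext R (ModuleCat R) (n + 1)).obj (Opposite.op M)).mapIso e').isZero_iff,
        ModuleCat.isZero_iff_subsingleton]
      exact h
    have ht := tor_of_ext (ModuleCat.of R E) (S := S) hS M n h'
    obtain ⟨m, hm⟩ := pd_of_projDim R X (hsr X hX (n + 1) (by omega) ht)
    have hXp := free_of_pd R m X
    have hXp' : Projective X := (IsProjective.iff_projective X).1 hXp
    have := injective_hom (ModuleCat.of R E) X
    have h3 : Injective (ModuleCat.of R (X ⟶ ModuleCat.of R E)) :=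
      Module.injective_object_of_injective_module R (X ⟶ ModuleCat.of R E)
    exact Injective.of_iso e'.symm h3
end
end
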